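/- arXiv:1109.1456 — 4 statements merged into one kernel-verified Lean document; each statement's English description precedes it below -/
import Mathlib

section
/- Let E be a smooth homogeneous cubic in S = ℂ[z₀,…,z₄] with Jacobian ideal J and Jacobian ring R = S/J. Then the graded pieces of R have dimensions dim_ℂ R^0 = dim_ℂ R^5 = 1, dim_ℂ R^1 = dim_ℂ R^4 = 5, dim_ℂ R^2 = dim_ℂ R^3 = 10, and R^d = 0 for all d ≥ 6. -/
open MvPolynomial Module

noncomputable section

/-- The Jacobian ideal of a polynomial `E`, generated by its five partial derivatives. -/
def jacobianIdeal (E : MvPolynomial (Fin 5) ℂ) : Ideal (MvPolynomial (Fin 5) ℂ) :=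
  Ideal.span (Set.range fun i => pderiv i E)

/-- `E` is a smooth cubic: it is homogeneous of degree 3 and the only common zero of its
partial derivatives is the origin. -/
def IsSmoothCubic (E : MvPolynomial (Fin 5) ℂ) : Prop :=
  E.IsHomogeneous 3 ∧ ∀ x : Fin 5 → ℂ, (∀ i, eval x (pderiv i E) = 0) → x = 0

/-- The degree-`d` graded piece `R^d = S^d/J_d` of the Jacobian ring, realized as the image
of the homogeneous polynomials of degree `d` in the quotient `S/J`. -/
def Rpiece (E : MvPolynomial (Fin 5) ℂ) (d : ℕ) :
    Submodule ℂ (MvPolynomial (Fin 5) ℂ ⧸ (jacobianIdeal E).restrictScalars ℂ) :=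
  Submodule.map (Submodule.mkQ ((jacobianIdeal E).restrictScalars ℂ))
    (homogeneousSubmodule (Fin 5) ℂ d)

section GradedIdeals

open RingTheory.Sequence Pointwise
open scoped List

attribute [local instance] MvPolynomial.gradedAlgebra

variable {σ K : Type*} [Field K]

/-- Multiplying by a homogeneous polynomial of degree `e` shifts homogeneous components by `e`. -/
theorem homogeneousComponent_mul_of_isHomogeneous {a : MvPolynomial σ K} {e : ℕ}
    (ha : a.IsHomogeneous e) (q : MvPolynomial σ K) (d : ℕ) :
    homogeneousComponent d (a * q) =
      if e ≤ d then a * homogeneousComponent (d - e) q else 0 := by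
  simp only [← decomposition.decompose'_apply]
  exact DirectSum.coe_decompose_mul_of_left_mem (homogeneousSubmodule σ K) d ha

/-- An ideal generated by a list of homogeneous polynomials is homogeneous. -/
theorem isHomogeneous_ofList {L : List (MvPolynomial σ K)}
    (hL : ∀ r ∈ L, ∃ e, r.IsHomogeneous e) :
    (Ideal.ofList L).IsHomogeneous (homogeneousSubmodule σ K) :=
  Ideal.homogeneous_span _ _ hL

theorem ofList_smul_top (L : List (MvPolynomial σ K)) :
    (Ideal.ofList L • ⊤ : Submodule (MvPolynomial σ K) (MvPolynomial σ K)) = Ideal.ofList L := by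
  rw [smul_eq_mul, Ideal.mul_top]

/-- Krull intersection for homogeneous ideals: a polynomial congruent modulo a homogeneous ideal
to multiples of all powers of a homogeneous polynomial of positive degree lies in the ideal. -/
theorem mem_of_forall_sub_pow_mul_mem {I : Ideal (MvPolynomial σ K)}
    (hI : I.IsHomogeneous (homogeneousSubmodule σ K)) {a : MvPolynomial σ K} {e : ℕ}
    (he : 0 < e) (ha : a.IsHomogeneous e) {p : MvPolynomial σ K}
    (hp : ∀ n : ℕ, ∃ q, p - a ^ n * q ∈ I) : p ∈ I := by
  rw [mem_iff_homogeneousComponent_mem hI]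
  intro d
  obtain ⟨q, hq⟩ := hp (d + 1)
  have h := homogeneousComponent_mem_of_mem hI hq d
  have hlt : ¬ e * (d + 1) ≤ d := by nlinarith
  rwa [map_sub, homogeneousComponent_mul_of_isHomogeneous (ha.pow _), if_neg hlt, sub_zero] at h

/-- Weakly regular sequences of homogeneous polynomials of positive degree may be permuted. -/
theorem isWeaklyRegular_perm_of_isHomogeneous {L L' : List (MvPolynomial σ K)}
    (hL : ∀ r ∈ L, ∃ e, 0 < e ∧ r.IsHomogeneous e)
    (h : IsWeaklyRegular (MvPolynomial σ K) L) (hLL' : L ~ L') :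
    IsWeaklyRegular (MvPolynomial σ K) L' := by
  refine h.prototype_perm hLL' fun a b L₀ hsub ↦ ?_
  intro T hT
  obtain ⟨e, he, ha⟩ := hL a (hsub.subset (by simp))
  have hI : (Ideal.ofList L₀).IsHomogeneous (homogeneousSubmodule σ K) :=
    isHomogeneous_ofList fun r hr ↦ (hL r (hsub.subset (by simp [hr]))).imp fun _ h ↦ h.2
  have hpow : ∀ n : ℕ, ∀ x ∈ T, ∃ y, x = a ^ n • y := by
    intro n
    induction n with
    | zero => exact fun x _ ↦ ⟨x, by simp⟩
    | succ n ih =>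
      intro x hx
      rw [hT] at hx
      obtain ⟨y, hy, rfl⟩ := (Submodule.mem_smul_pointwise_iff_exists _ _ _).mp hx
      obtain ⟨z, rfl⟩ := ih y hy
      exact ⟨z, by rw [smul_smul, pow_succ']⟩
  rw [eq_bot_iff]
  intro x hx
  obtain ⟨p, rfl⟩ := Submodule.mkQ_surjective _ x
  rw [Submodule.mem_bot, Submodule.mkQ_apply, Submodule.Quotient.mk_eq_zero, ofList_smul_top]
  refine mem_of_forall_sub_pow_mul_mem hI he ha fun n ↦ ?_
  obtain ⟨y, hy⟩ := hpow n _ hx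
  obtain ⟨q, rfl⟩ := Submodule.mkQ_surjective _ y
  refine ⟨q, ?_⟩
  rwa [← map_smul, Submodule.mkQ_apply, Submodule.mkQ_apply, Submodule.Quotient.eq,
    ofList_smul_top] at hy

/-- Distinct variables form a weakly regular sequence. -/
theorem isWeaklyRegular_map_X {l : List σ} (hl : l.Nodup) :
    IsWeaklyRegular (MvPolynomial σ K) (l.map (X : σ → MvPolynomial σ K)) := by
  refine ⟨fun i hi ↦ ?_⟩
  have hspan : Ideal.ofList ((l.map (X : σ → MvPolynomial σ K)).take i) =
      Ideal.span (X '' {j | j ∈ l.take i}) := by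
    rw [← List.map_take, Ideal.ofList]
    congr 1
    ext
    simp only [List.mem_map, Set.mem_image, Set.mem_ofPred_eq]
  rw [isSMulRegular_quotient_iff_mem_of_smul_mem, ofList_smul_top, hspan]
  intro p hp
  rw [List.getElem_map, smul_eq_mul, mem_ideal_span_X_image] at hp
  rw [mem_ideal_span_X_image]
  intro m hm
  have hi' : i < l.length := by simpa using hi
  obtain ⟨j, hj, hne⟩ := hp (Finsupp.single l[i] 1 + m) (by
    rwa [MvPolynomial.mem_support_iff, coeff_X_mul, ← MvPolynomial.mem_support_iff])
  refine ⟨j, hj, ?_⟩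
  have hji : l[i] ≠ j := by
    rintro rfl
    obtain ⟨k, hk, hkeq⟩ := List.mem_take_iff_getElem.mp hj
    have := (hl.getElem_inj_iff).mp hkeq
    omega
  simpa [Finsupp.single_eq_of_ne' hji] using hne

/-- If some element regular modulo `I` lies in the radical of the ideal generated by a
vector space `V`, then some element of `V` is regular modulo `I`. -/
theorem exists_mem_isSMulRegular_quotient [Finite σ] [Infinite K]
    (I : Ideal (MvPolynomial σ K)) (V : Submodule K (MvPolynomial σ K)) {y : MvPolynomial σ K}
    (hy : IsSMulRegular (MvPolynomial σ K ⧸ I) y)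
    (hyV : y ∈ (Ideal.span (V : Set (MvPolynomial σ K))).radical) :
    ∃ v ∈ V, IsSMulRegular (MvPolynomial σ K ⧸ I) v := by
  by_contra! hV
  have hass := biUnion_associatedPrimes_eq_compl_regular (MvPolynomial σ K)
    (MvPolynomial σ K ⧸ I)
  have := (associatedPrimes.finite (MvPolynomial σ K) (MvPolynomial σ K ⧸ I)).to_subtype
  obtain ⟨⟨P, hP⟩, hPV⟩ := Subspace.exists_eq_top_of_iUnion_eq_univ
    (p := fun P : associatedPrimes (MvPolynomial σ K) (MvPolynomial σ K ⧸ I) ↦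
      (P.1.restrictScalars K).comap V.subtype) (by
    rw [Set.eq_univ_iff_forall]
    rintro ⟨v, hv⟩
    have hmem : v ∈ {r : MvPolynomial σ K | IsSMulRegular (MvPolynomial σ K ⧸ I) r}ᶜ := hV v hv
    rw [← hass] at hmem
    simpa using hmem)
  have hVP : Ideal.span (V : Set (MvPolynomial σ K)) ≤ P :=
    Ideal.span_le.mpr fun v hv ↦ by
      have : (⟨v, hv⟩ : V) ∈ (P.restrictScalars K).comap V.subtype := hPV ▸ Submodule.mem_top
      exact this
  have hyP : y ∈ P := (IsAssociatedPrime.isPrime hP).radical_le_iff.mpr hVP hyV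
  have hmem : y ∈ {r : MvPolynomial σ K | IsSMulRegular (MvPolynomial σ K ⧸ I) r}ᶜ := by
    rw [← hass]
    exact Set.mem_biUnion hP hyP
  exact hmem hy

/-- The members of a homogeneous regular sequence can be exchanged one by one for members of a
space `V` of forms of degree `e` having all of them in the radical of the ideal it generates. -/
theorem exists_isWeaklyRegular_of_le_radical [Finite σ] [Infinite K] {e : ℕ} (he : 0 < e)
    {V : Submodule K (MvPolynomial σ K)} (hV : V ≤ homogeneousSubmodule σ K e)
    {L : List (MvPolynomial σ K)} (hL : ∀ r ∈ L, ∃ e, 0 < e ∧ r.IsHomogeneous e)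
    (hLV : ∀ r ∈ L, r ∈ (Ideal.span (V : Set (MvPolynomial σ K))).radical)
    (hreg : IsWeaklyRegular (MvPolynomial σ K) L) :
    ∃ G : List (MvPolynomial σ K), G.length = L.length ∧ (∀ g ∈ G, g ∈ V) ∧
      IsWeaklyRegular (MvPolynomial σ K) G := by
  suffices H : ∀ G : List (MvPolynomial σ K), (∀ g ∈ G, g ∈ V) →
      IsWeaklyRegular (MvPolynomial σ K) (L ++ G) →
      ∃ G' : List (MvPolynomial σ K), G'.length = L.length + G.length ∧ (∀ g ∈ G', g ∈ V) ∧
        IsWeaklyRegular (MvPolynomial σ K) G' by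
    simpa using H [] (by simp) (by simpa using hreg)
  clear hreg
  induction L with
  | nil => exact fun G hG h ↦ ⟨G, by simp, hG, by simpa using h⟩
  | cons x L ih =>
    intro G hG h
    have hperm : IsWeaklyRegular (MvPolynomial σ K) ((L ++ G) ++ [x]) := by
      refine isWeaklyRegular_perm_of_isHomogeneous (fun r hr ↦ ?_) h
        (List.perm_append_singleton x (L ++ G)).symm
      rcases List.mem_append.mp hr with hr | hr
      · exact hL r hr
      · exact ⟨e, he, hV (hG r hr)⟩
    rw [isWeaklyRegular_append_iff, isWeaklyRegular_singleton_iff] at hperm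
    obtain ⟨v, hv, hvreg⟩ := exists_mem_isSMulRegular_quotient _ V hperm.2 (hLV x (by simp))
    obtain ⟨G', hlen, hG', hreg⟩ := ih (fun r hr ↦ hL r (by simp [hr]))
      (fun r hr ↦ hLV r (by simp [hr])) (G ++ [v])
      (by simpa [or_imp, forall_and] using ⟨hG, hv⟩)
      (by
        rw [← List.append_assoc, isWeaklyRegular_append_iff, isWeaklyRegular_singleton_iff]
        exact ⟨hperm.1, hvreg⟩)
    exact ⟨G', by simp [hlen]; omega, hG', hreg⟩

end GradedIdeals

section HilbertFunction

open RingTheory.Sequence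

attribute [local instance] MvPolynomial.gradedAlgebra

variable {σ K : Type*} [Field K]

instance finiteDimensional_homogeneousSubmodule [Finite σ] (d : ℕ) :
    FiniteDimensional K (homogeneousSubmodule σ K d) :=
  Module.Finite.iff_fg.mpr (homogeneousSubmodule_fg σ K d)

theorem finrank_homogeneousSubmodule [Fintype σ] (d : ℕ) :
    finrank K (homogeneousSubmodule σ K d) = (Fintype.card σ + d - 1).choose d := by
  classical
  rw [homogeneousSubmodule_eq_finsupp_supported]
  have hset : {m : σ →₀ ℕ | m.degree = d} = (Finset.univ : Finset σ).finsuppAntidiag d := by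
    ext m
    simp [Finsupp.degree_eq_sum]
  rw [hset, (AddMonoidAlgebra.supportedEquivFinsupp (R := K) (S := K) _).finrank_eq,
    finrank_finsupp_self]
  simp only [Finset.coe_sort_coe, Fintype.card_coe]
  exact Finset.card_finsuppAntidiag_nat_eq_choose _

/-- The degree-`d` part of an ideal. -/
def gradedPart (I : Ideal (MvPolynomial σ K)) (d : ℕ) : Submodule K (MvPolynomial σ K) :=
  homogeneousSubmodule σ K d ⊓ I.restrictScalars K

/-- The Hilbert function of the quotient by an ideal. -/
def hilbertFun (I : Ideal (MvPolynomial σ K)) (d : ℕ) : ℤ :=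
  finrank K (homogeneousSubmodule σ K d) - finrank K (gradedPart I d)

theorem mem_gradedPart {I : Ideal (MvPolynomial σ K)} {d : ℕ} {p : MvPolynomial σ K} :
    p ∈ gradedPart I d ↔ p.IsHomogeneous d ∧ p ∈ I :=
  Iff.rfl

theorem gradedPart_mono {I J : Ideal (MvPolynomial σ K)} (h : I ≤ J) (d : ℕ) :
    gradedPart I d ≤ gradedPart J d :=
  fun _ hp ↦ ⟨hp.1, h hp.2⟩

instance [Finite σ] (I : Ideal (MvPolynomial σ K)) (d : ℕ) :
    FiniteDimensional K (gradedPart I d) :=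
  Submodule.finiteDimensional_of_le (inf_le_left (b := I.restrictScalars K))

theorem hilbertFun_top (d : ℕ) : hilbertFun (⊤ : Ideal (MvPolynomial σ K)) d = 0 := by
  rw [hilbertFun, gradedPart, Submodule.restrictScalars_top, inf_top_eq, sub_self]

variable {I : Ideal (MvPolynomial σ K)} {a : MvPolynomial σ K} {e d : ℕ}

theorem gradedPart_sup_span_of_lt (hI : I.IsHomogeneous (homogeneousSubmodule σ K))
    (ha : a.IsHomogeneous e) (hd : d < e) :
    gradedPart (I ⊔ Ideal.span {a}) d = gradedPart I d := by
  refine le_antisymm (fun p hp ↦ ⟨hp.1, ?_⟩) (gradedPart_mono le_sup_left d)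
  obtain ⟨i, hi, j, hj, hij⟩ := Submodule.mem_sup.mp hp.2
  obtain ⟨q, rfl⟩ := Ideal.mem_span_singleton'.mp hj
  have h := homogeneousComponent_mem_of_mem hI hi d
  rwa [eq_sub_of_add_eq hij, map_sub, mul_comm, homogeneousComponent_mul_of_isHomogeneous ha,
    if_neg hd.not_ge, sub_zero, homogeneousComponent_eq_self hp.1] at h

theorem gradedPart_sup_span_of_le (hI : I.IsHomogeneous (homogeneousSubmodule σ K))
    (ha : a.IsHomogeneous e) (hd : e ≤ d) :
    gradedPart (I ⊔ Ideal.span {a}) d =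
      gradedPart I d ⊔ (homogeneousSubmodule σ K (d - e)).map (LinearMap.mulLeft K a) := by
  apply le_antisymm
  · intro p hp
    obtain ⟨i, hi, j, hj, hij⟩ := Submodule.mem_sup.mp hp.2
    obtain ⟨q, rfl⟩ := Ideal.mem_span_singleton'.mp hj
    refine Submodule.mem_sup.mpr ⟨homogeneousComponent d i,
      ⟨homogeneousComponent_mem _ _, homogeneousComponent_mem_of_mem hI hi d⟩,
      a * homogeneousComponent (d - e) q, ⟨_, homogeneousComponent_mem _ _, rfl⟩, ?_⟩
    rw [← homogeneousComponent_eq_self hp.1, ← hij, map_add, mul_comm q,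
      homogeneousComponent_mul_of_isHomogeneous ha, if_pos hd]
  · refine sup_le (gradedPart_mono le_sup_left d) ?_
    rintro _ ⟨q, hq, rfl⟩
    refine ⟨?_, Ideal.mem_sup_right (Ideal.mul_mem_right _ _ (Ideal.mem_span_singleton_self a))⟩
    have := ha.mul hq
    rwa [Nat.add_sub_cancel' hd] at this

theorem gradedPart_inf_map_mulLeft (ha : a.IsHomogeneous e) (hd : e ≤ d)
    (hreg : IsSMulRegular (MvPolynomial σ K ⧸ I) a) :
    gradedPart I d ⊓ (homogeneousSubmodule σ K (d - e)).map (LinearMap.mulLeft K a) =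
      (gradedPart I (d - e)).map (LinearMap.mulLeft K a) := by
  apply le_antisymm
  · rintro _ ⟨hp, q, hq, rfl⟩
    exact ⟨q, ⟨hq, (isSMulRegular_quotient_iff_mem_of_smul_mem I a).mp hreg q hp.2⟩, rfl⟩
  · rintro _ ⟨q, hq, rfl⟩
    refine ⟨⟨?_, Ideal.mul_mem_left _ _ hq.2⟩, q, hq.1, rfl⟩
    have := ha.mul hq.1
    rwa [Nat.add_sub_cancel' hd] at this

/-- The Hilbert function after dividing by a homogeneous regular element. -/
theorem hilbertFun_sup_span [Finite σ] (hI : I.IsHomogeneous (homogeneousSubmodule σ K))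
    (ha : a.IsHomogeneous e) (hreg : IsSMulRegular (MvPolynomial σ K ⧸ I) a) (d : ℕ) :
    hilbertFun (I ⊔ Ideal.span {a}) d =
      hilbertFun I d - if e ≤ d then hilbertFun I (d - e) else 0 := by
  split_ifs with hd
  · rcases eq_or_ne a 0 with rfl | ha0
    · obtain rfl : I = ⊤ := by
        rw [Ideal.eq_top_iff_one]
        exact (isSMulRegular_quotient_iff_mem_of_smul_mem I 0).mp hreg 1 (by simp)
      simp only [top_sup_eq, hilbertFun_top, sub_zero]
    · have hinj : Function.Injective (LinearMap.mulLeft K a) := fun _ _ h ↦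
        mul_left_cancel₀ ha0 h
      have h := Submodule.finrank_sup_add_finrank_inf_eq (gradedPart I d)
        ((homogeneousSubmodule σ K (d - e)).map (LinearMap.mulLeft K a))
      rw [← gradedPart_sup_span_of_le hI ha hd, gradedPart_inf_map_mulLeft ha hd hreg,
        ← (Submodule.equivMapOfInjective _ hinj _).finrank_eq,
        ← (Submodule.equivMapOfInjective _ hinj _).finrank_eq] at h
      simp only [hilbertFun]
      omega
  · rw [hilbertFun, gradedPart_sup_span_of_lt hI ha (not_le.mp hd), sub_zero, hilbertFun]

/-- The Hilbert function of the quotient of a polynomial ring in `n` variables by a regular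
sequence of `k` quadrics. -/
def quadricsHilbertFun (n : ℕ) : ℕ → ℕ → ℤ
  | 0, d => (n + d - 1).choose d
  | k + 1, d => quadricsHilbertFun n k d - if 2 ≤ d then quadricsHilbertFun n k (d - 2) else 0

theorem hilbertFun_ofList_quadrics [Fintype σ] {L : List (MvPolynomial σ K)}
    (hL : ∀ r ∈ L, r.IsHomogeneous 2) (hreg : IsWeaklyRegular (MvPolynomial σ K) L) (d : ℕ) :
    hilbertFun (Ideal.ofList L) d = quadricsHilbertFun (Fintype.card σ) L.length d := by
  induction L using List.reverseRecOn generalizing d with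
  | nil =>
    have : gradedPart (⊥ : Ideal (MvPolynomial σ K)) d = ⊥ := by
      simp [gradedPart]
    simp [hilbertFun, quadricsHilbertFun, this, finrank_homogeneousSubmodule]
  | append_singleton L a ih =>
    rw [isWeaklyRegular_append_iff, isWeaklyRegular_singleton_iff, ofList_smul_top] at hreg
    have hL' : ∀ r ∈ L, r.IsHomogeneous 2 := fun r hr ↦ hL r (by simp [hr])
    rw [Ideal.ofList_append, Ideal.ofList_singleton,
      hilbertFun_sup_span (isHomogeneous_ofList fun r hr ↦ ⟨2, hL' r hr⟩) (hL a (by simp)) hreg.2,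
      ih hL' hreg.1, ih hL' hreg.1]
    simp [quadricsHilbertFun]

/-- The lowest-degree part of an ideal generated by forms of degree `e` is spanned by them. -/
theorem gradedPart_ofList_le_span {L : List (MvPolynomial σ K)}
    (hL : ∀ r ∈ L, r.IsHomogeneous e) :
    gradedPart (Ideal.ofList L) e ≤ Submodule.span K {r | r ∈ L} := by
  induction L using List.reverseRecOn with
  | nil => simp [gradedPart]
  | append_singleton L a ih =>
    have hL' : ∀ r ∈ L, r.IsHomogeneous e := fun r hr ↦ hL r (by simp [hr])
    rw [Ideal.ofList_append, Ideal.ofList_singleton,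
      gradedPart_sup_span_of_le (isHomogeneous_ofList fun r hr ↦ ⟨e, hL' r hr⟩)
        (hL a (by simp)) le_rfl]
    refine sup_le ((ih hL').trans (Submodule.span_mono fun r hr ↦ by simp_all)) ?_
    rintro _ ⟨q, hq, rfl⟩
    rw [Nat.sub_self, SetLike.mem_coe, mem_homogeneousSubmodule,
      ← totalDegree_zero_iff_isHomogeneous, totalDegree_eq_zero_iff_eq_C] at hq
    rw [hq, LinearMap.mulLeft_apply, mul_comm, C_mul']
    exact Submodule.smul_mem _ _ (Submodule.subset_span (by simp))

theorem finrank_map_mkQ_homogeneousSubmodule [Finite σ] (I : Ideal (MvPolynomial σ K)) (d : ℕ) :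
    (finrank K ((homogeneousSubmodule σ K d).map (I.restrictScalars K).mkQ) : ℤ) =
      hilbertFun I d := by
  have h := LinearMap.finrank_range_add_finrank_ker
    ((I.restrictScalars K).mkQ.domRestrict (homogeneousSubmodule σ K d))
  rw [LinearMap.range_domRestrict, LinearMap.ker_domRestrict, Submodule.ker_mkQ,
    ← Submodule.finrank_map_subtype_eq, Submodule.map_comap_subtype] at h
  rw [hilbertFun, gradedPart]
  omega

end HilbertFunction

section SmoothCubic

open RingTheory.Sequence

theorem X_mem_radical_jacobianIdeal {E : MvPolynomial (Fin 5) ℂ} (hE : IsSmoothCubic E)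
    (i : Fin 5) : X i ∈ (jacobianIdeal E).radical := by
  rw [← vanishingIdeal_zeroLocus_eq_radical (K := ℂ), mem_vanishingIdeal_iff]
  intro x hx
  have hx0 : x = 0 := hE.2 x fun j ↦ by
    simpa [aeval_eq_eval] using hx _ (Ideal.subset_span ⟨j, rfl⟩)
  simp [hx0]

/-- The Jacobian ideal of a smooth cubic is generated by a regular sequence of five quadrics. -/
theorem exists_isWeaklyRegular_ofList_eq_jacobianIdeal {E : MvPolynomial (Fin 5) ℂ}
    (hE : IsSmoothCubic E) :
    ∃ G : List (MvPolynomial (Fin 5) ℂ), G.length = 5 ∧ (∀ g ∈ G, g.IsHomogeneous 2) ∧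
      IsWeaklyRegular (MvPolynomial (Fin 5) ℂ) G ∧ Ideal.ofList G = jacobianIdeal E := by
  set V := Submodule.span ℂ (Set.range fun i ↦ pderiv i E) with hV
  have hV2 : V ≤ homogeneousSubmodule (Fin 5) ℂ 2 := by
    rw [hV, Submodule.span_le]
    rintro _ ⟨i, rfl⟩
    exact hE.1.pderiv
  have hVJ : Ideal.span (V : Set (MvPolynomial (Fin 5) ℂ)) = jacobianIdeal E :=
    Submodule.span_span_of_tower _ _ _
  obtain ⟨G, hlen, hGV, hreg⟩ := exists_isWeaklyRegular_of_le_radical two_pos hV2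
    (L := (List.finRange 5).map X)
    (by
      simp only [List.mem_map]
      rintro _ ⟨i, -, rfl⟩
      exact ⟨1, one_pos, isHomogeneous_X _ i⟩)
    (by
      simp only [List.mem_map]
      rintro _ ⟨i, -, rfl⟩
      exact hVJ ▸ X_mem_radical_jacobianIdeal hE i)
    (isWeaklyRegular_map_X (List.nodup_finRange 5))
  replace hlen : G.length = 5 := by simpa using hlen
  have hG2 : ∀ g ∈ G, g.IsHomogeneous 2 := fun g hg ↦ hV2 (hGV g hg)
  refine ⟨G, hlen, hG2, hreg, ?_⟩
  have hWV : Submodule.span ℂ {g | g ∈ G} ≤ V := Submodule.span_le.mpr hGV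
  have hfin : FiniteDimensional ℂ V := FiniteDimensional.span_of_finite ℂ (Set.finite_range _)
  have hdim : finrank ℂ V ≤ finrank ℂ (gradedPart (Ideal.ofList G) 2) := by
    have h := hilbertFun_ofList_quadrics hG2 hreg 2
    rw [hlen, Fintype.card_fin, hilbertFun, finrank_homogeneousSubmodule, Fintype.card_fin,
      show quadricsHilbertFun 5 5 2 = 10 by decide, show Nat.choose (5 + 2 - 1) 2 = 15 by decide] at h
    have : finrank ℂ V ≤ 5 :=
      (finrank_range_le_card (R := ℂ) fun i ↦ pderiv i E).trans_eq (Fintype.card_fin 5)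
    omega
  have hGle : gradedPart (Ideal.ofList G) 2 ≤ V := (gradedPart_ofList_le_span hG2).trans hWV
  have heq := Submodule.eq_of_le_of_finrank_le hGle hdim
  apply le_antisymm
  · rw [← hVJ]
    exact Ideal.span_mono hGV
  · rw [← hVJ, Ideal.span_le, ← heq]
    exact fun p hp ↦ hp.2

theorem hilbertFun_jacobianIdeal {E : MvPolynomial (Fin 5) ℂ} (hE : IsSmoothCubic E) (d : ℕ) :
    hilbertFun (jacobianIdeal E) d = quadricsHilbertFun 5 5 d := by
  obtain ⟨G, hlen, hG2, hreg, hGJ⟩ := exists_isWeaklyRegular_ofList_eq_jacobianIdeal hE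
  rw [← hGJ, hilbertFun_ofList_quadrics hG2 hreg, hlen, Fintype.card_fin]

theorem finrank_Rpiece {E : MvPolynomial (Fin 5) ℂ} (hE : IsSmoothCubic E) (d : ℕ) :
    (finrank ℂ (Rpiece E d) : ℤ) = quadricsHilbertFun 5 5 d := by
  rw [Rpiece, finrank_map_mkQ_homogeneousSubmodule, hilbertFun_jacobianIdeal hE]

theorem homogeneousSubmodule_le_jacobianIdeal {E : MvPolynomial (Fin 5) ℂ}
    (hE : IsSmoothCubic E) {d : ℕ} (hd : 6 ≤ d) :
    homogeneousSubmodule (Fin 5) ℂ d ≤ (jacobianIdeal E).restrictScalars ℂ := by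
  have h6 : homogeneousSubmodule (Fin 5) ℂ 6 ≤ (jacobianIdeal E).restrictScalars ℂ := by
    have h := hilbertFun_jacobianIdeal hE 6
    rw [show quadricsHilbertFun 5 5 6 = 0 by decide, hilbertFun] at h
    have heq : gradedPart (jacobianIdeal E) 6 = homogeneousSubmodule (Fin 5) ℂ 6 :=
      Submodule.eq_of_le_of_finrank_le (fun p hp ↦ hp.1) (by omega)
    exact heq ▸ fun p hp ↦ hp.2
  have hpow : idealOfVars (Fin 5) ℂ ^ 6 ≤ jacobianIdeal E := by
    rw [pow_idealOfVars_eq_span, Ideal.span_le]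
    rintro _ ⟨m, hm, rfl⟩
    exact h6 (isHomogeneous_monomial 1 hm)
  intro p hp
  refine hpow ((mem_pow_idealOfVars_iff 6 p).mpr fun m hm ↦ ?_)
  have := IsHomogeneous.degree_eq_sum_deg_support hp hm
  rw [Finsupp.degree_apply]
  omega

end SmoothCubic

theorem statement0 (E : MvPolynomial (Fin 5) ℂ) (hE : IsSmoothCubic E) :
    finrank ℂ (Rpiece E 0) = 1 ∧ finrank ℂ (Rpiece E 5) = 1 ∧
    finrank ℂ (Rpiece E 1) = 5 ∧ finrank ℂ (Rpiece E 4) = 5 ∧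
    finrank ℂ (Rpiece E 2) = 10 ∧ finrank ℂ (Rpiece E 3) = 10 ∧
    ∀ d : ℕ, 6 ≤ d → Rpiece E d = ⊥ := by
  have h := finrank_Rpiece hE
  have h0 : quadricsHilbertFun 5 5 0 = 1 := by decide
  have h1 : quadricsHilbertFun 5 5 1 = 5 := by decide
  have h2 : quadricsHilbertFun 5 5 2 = 10 := by decide
  have h3 : quadricsHilbertFun 5 5 3 = 10 := by decide
  have h4 : quadricsHilbertFun 5 5 4 = 5 := by decide
  have h5 : quadricsHilbertFun 5 5 5 = 1 := by decide
  refine ⟨by grind, by grind, by grind, by grind, by grind, by grind, fun d hd ↦ ?_⟩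
  rw [Rpiece, ← le_bot_iff, Submodule.map_le_iff_le_comap, Submodule.comap_bot, Submodule.ker_mkQ]
  exact homogeneousSubmodule_le_jacobianIdeal hE hd
end
end

section
/- Let E be a smooth homogeneous cubic in S = ℂ[z₀,…,z₄] with Jacobian ring R = S/J. For each i with 0 ≤ i ≤ 5, the multiplication map R^i × R^{5−i} → R^5 is a perfect pairing: R^5 is 1-dimensional, and for every nonzero a ∈ R^i there exists b ∈ R^{5−i} with a·b ≠ 0 in R^5 (and symmetrically for every nonzero b ∈ R^{5−i} there exists a ∈ R^i with a·b ≠ 0). -/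
open MvPolynomial Module

noncomputable section

/-! ### Sequences all of whose subfamilies are regular -/

/-- Every member of the family `f` is a nonzerodivisor modulo any set of other members. -/
def IsStronglyRegular {ι A : Type*} [CommRing A] (f : ι → A) : Prop :=
  ∀ (T : Set ι) (i : ι), i ∉ T → ∀ x, f i * x ∈ Ideal.span (f '' T) → x ∈ Ideal.span (f '' T)

/-- Prime avoidance over an infinite field: a subspace whose ideal contains a power of an element
regular modulo `I` contains itself an element regular modulo `I`. -/
lemma exists_mem_regular_mod {K A : Type*} [Field K] [Infinite K] [CommRing A] [Algebra K A]
    [IsNoetherianRing A] {I : Ideal A} {V : Submodule K A} {u : A}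
    (hu : ∀ x, u * x ∈ I → x ∈ I) {N : ℕ} (huN : u ^ N ∈ Ideal.span (V : Set A)) :
    ∃ v ∈ V, ∀ x, v * x ∈ I → x ∈ I := by
  have : Finite (associatedPrimes A (A ⧸ I)) := associatedPrimes.finite A (A ⧸ I)
  have hcover := biUnion_associatedPrimes_eq_zero_divisors A (A ⧸ I)
  by_contra! hcon
  obtain ⟨P, hP⟩ := Subspace.exists_eq_top_of_iUnion_eq_univ (k := K) (E := V)
    (p := fun P : associatedPrimes A (A ⧸ I) =>
      ((P : Ideal A).restrictScalars K).comap V.subtype) (by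
    refine Set.eq_univ_of_forall fun v => ?_
    obtain ⟨x, hx, hxI⟩ := hcon v v.2
    have hv : (v : A) ∈ ⋃ p ∈ associatedPrimes A (A ⧸ I), (p : Set A) := by
      rw [hcover]
      refine ⟨Ideal.Quotient.mk I x, ?_, ?_⟩
      · rwa [Ne, Ideal.Quotient.eq_zero_iff_mem]
      · rw [Algebra.smul_def, Ideal.Quotient.algebraMap_eq, ← map_mul,
          Ideal.Quotient.eq_zero_iff_mem]
        exact hx
    simp only [Set.mem_iUnion] at hv ⊢
    obtain ⟨p, hp, hvp⟩ := hv
    exact ⟨⟨p, hp⟩, hvp⟩)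
  have hVP : (V : Set A) ⊆ (P : Ideal A) := fun v hv => by
    have : (⟨v, hv⟩ : V) ∈ ((P : Ideal A).restrictScalars K).comap V.subtype := by
      rw [hP]; trivial
    exact this
  have hprime : (P : Ideal A).IsPrime := P.2.isPrime
  have huP : u ∈ (P : Ideal A) := hprime.mem_of_pow_mem _ (Ideal.span_le.2 hVP huN)
  have huz : u ∈ ⋃ p ∈ associatedPrimes A (A ⧸ I), (p : Set A) :=
    Set.mem_iUnion₂_of_mem P.2 huP
  rw [hcover] at huz
  obtain ⟨x, hx, hux⟩ := huz
  obtain ⟨x, rfl⟩ := Ideal.Quotient.mk_surjective x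
  rw [Algebra.smul_def, Ideal.Quotient.algebraMap_eq, ← map_mul,
    Ideal.Quotient.eq_zero_iff_mem] at hux
  exact hx (Ideal.Quotient.eq_zero_iff_mem.2 (hu x hux))

section Graded

variable {K σ : Type*} [Field K]

lemma homogeneousComponent_mem_span {s : Set (MvPolynomial σ K)}
    (hs : ∀ p ∈ s, ∃ n, p.IsHomogeneous n) {x : MvPolynomial σ K} (hx : x ∈ Ideal.span s)
    (d : ℕ) : homogeneousComponent d x ∈ Ideal.span s :=
  let := gradedAlgebra (σ := σ) (R := K)
  homogeneousComponent_mem_of_mem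
    (Ideal.homogeneous_span _ s fun p hp => (hs p hp).imp fun _ h => h) hx d

lemma homogeneousComponent_mul_of_isHomogeneous_s1 {p : MvPolynomial σ K} {n : ℕ}
    (hp : p.IsHomogeneous n) (q : MvPolynomial σ K) (d : ℕ) :
    homogeneousComponent (n + d) (p * q) = p * homogeneousComponent d q := by
  let := gradedAlgebra (σ := σ) (R := K)
  have h := DirectSum.coe_decompose_mul_add_of_left_mem (homogeneousSubmodule σ K)
    (i := n) (j := d) (a := p) (b := q) hp
  have key : ∀ (φ : MvPolynomial σ K) (i : ℕ),
      (DirectSum.decompose (homogeneousSubmodule σ K) φ i : MvPolynomial σ K) =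
        homogeneousComponent i φ := decomposition.decompose'_apply
  rwa [key, key] at h

lemma MvPolynomial.IsHomogeneous.mem_idealOfVars_pow {p : MvPolynomial σ K} {n k : ℕ}
    (hp : p.IsHomogeneous n) (hk : k ≤ n) : p ∈ idealOfVars σ K ^ k := by
  rw [mem_pow_idealOfVars_iff']
  intro x hx
  exact hp.coeff_eq_zero (by omega)

lemma mul_mem_of_mem_idealOfVars {I : Ideal (MvPolynomial σ K)} {x : MvPolynomial σ K}
    (hx : ∀ i, X i * x ∈ I) {w : MvPolynomial σ K} (hw : w ∈ idealOfVars σ K) : w * x ∈ I := by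
  have : idealOfVars σ K ≤ Submodule.colon I {x} := by
    refine Ideal.span_le.2 ?_
    rintro _ ⟨i, rfl⟩
    simpa [Submodule.mem_colon_singleton] using hx i
  simpa [Submodule.mem_colon_singleton] using this hw

/-- Two elements of a graded regular sequence may be exchanged. -/
lemma regular_mod_of_regular_mod_insert {s : Set (MvPolynomial σ K)}
    (hs : ∀ p ∈ s, ∃ n, p.IsHomogeneous n) {a v : MvPolynomial σ K}
    (ham : a ∈ idealOfVars σ K)
    (ha : ∀ x, a * x ∈ Ideal.span s → x ∈ Ideal.span s)
    (hv : ∀ x, v * x ∈ Ideal.span (insert a s) → x ∈ Ideal.span (insert a s))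
    (x : MvPolynomial σ K) (hx : v * x ∈ Ideal.span s) : x ∈ Ideal.span s := by
  have key : ∀ k : ℕ, ∀ x, v * x ∈ Ideal.span s →
      ∃ y ∈ Ideal.span s, x - y ∈ idealOfVars σ K ^ k := by
    intro k
    induction k with
    | zero => exact fun x _ => ⟨0, zero_mem _, by simp⟩
    | succ k ih =>
      intro x hx
      obtain ⟨y, z, hz, rfl⟩ := Ideal.mem_span_insert.1
        (hv x (Ideal.span_mono (Set.subset_insert _ _) hx))
      have hvy : v * y ∈ Ideal.span s := by
        refine ha _ ?_
        have := sub_mem hx (Ideal.mul_mem_left _ v hz)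
        convert this using 1; ring
      obtain ⟨w, hw, hyw⟩ := ih y hvy
      refine ⟨a * w + z, add_mem (Ideal.mul_mem_left _ _ hw) hz, ?_⟩
      have : y * a + z - (a * w + z) = (y - w) * a := by ring
      rw [this, pow_succ]
      exact Ideal.mul_mem_mul hyw ham
  let := gradedAlgebra (σ := σ) (R := K)
  rw [mem_iff_homogeneousComponent_mem (Ideal.homogeneous_span _ s
    fun p hp => (hs p hp).imp fun _ h => h)]
  intro d
  obtain ⟨y, hy, hxy⟩ := key (d + 1) x hx
  have h0 : homogeneousComponent d (x - y) = 0 := by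
    ext m
    rw [coeff_homogeneousComponent]
    split_ifs with hm
    · exact (mem_pow_idealOfVars_iff' _ _).1 hxy m (by omega)
    · simp
  rw [map_sub, sub_eq_zero] at h0
  rw [h0]
  exact homogeneousComponent_mem_span hs hy d

lemma IsStronglyRegular.regular_mod {ι : Type*} [Finite ι] {f : ι → MvPolynomial σ K}
    (hf : IsStronglyRegular f) (hhom : ∀ i, ∃ n, (f i).IsHomogeneous n)
    (hfm : ∀ i, f i ∈ idealOfVars σ K) {k : ι} {v : MvPolynomial σ K}
    (hv : ∀ x, v * x ∈ Ideal.span (f '' {k}ᶜ) → x ∈ Ideal.span (f '' {k}ᶜ))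
    (T : Set ι) (hT : k ∉ T) (x : MvPolynomial σ K) (hx : v * x ∈ Ideal.span (f '' T)) :
    x ∈ Ideal.span (f '' T) := by
  classical
  have hs : ∀ T : Set ι, ∀ p ∈ f '' T, ∃ n, p.IsHomogeneous n := by
    rintro T _ ⟨i, _, rfl⟩; exact hhom i
  have key : ∀ U : Set ι, U.Finite → ∀ x, v * x ∈ Ideal.span (f '' ({k}ᶜ \ U)) →
      x ∈ Ideal.span (f '' ({k}ᶜ \ U)) := by
    intro U hU
    induction U, hU using Set.Finite.induction_on with
    | empty => simpa using hv
    | @insert a U haU _ ih =>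
      by_cases hak : a = k
      · have : ({k}ᶜ \ insert a U : Set ι) = {k}ᶜ \ U := by
          ext i; simp only [Set.mem_sdiff, Set.mem_compl_iff, Set.mem_singleton_iff,
            Set.mem_insert_iff, hak]; tauto
        rwa [this]
      · have : ({k}ᶜ \ U : Set ι) = insert a ({k}ᶜ \ insert a U) := by
          ext i; simp only [Set.mem_sdiff, Set.mem_compl_iff, Set.mem_singleton_iff,
            Set.mem_insert_iff]
          by_cases hia : i = a
          · subst hia; tauto
          · tauto
        rw [this, Set.image_insert_eq] at ih
        exact regular_mod_of_regular_mod_insert (hs _) (hfm a)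
          (hf _ a (by simp)) ih
  have hTU : T = {k}ᶜ \ ({k}ᶜ \ T) := by
    rw [sdiff_sdiff_right_self]
    exact (Set.inter_eq_right.2 (by simpa using hT)).symm
  rw [hTU] at hx ⊢
  exact key _ (Set.toFinite _) x hx

lemma IsStronglyRegular.update {ι : Type*} [Finite ι] [DecidableEq ι] {f : ι → MvPolynomial σ K}
    (hf : IsStronglyRegular f) (hhom : ∀ i, ∃ n, (f i).IsHomogeneous n)
    (hfm : ∀ i, f i ∈ idealOfVars σ K) {k : ι} {v : MvPolynomial σ K}
    (hv : ∀ x, v * x ∈ Ideal.span (f '' {k}ᶜ) → x ∈ Ideal.span (f '' {k}ᶜ)) :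
    IsStronglyRegular (Function.update f k v) := by
  have hreg := hf.regular_mod hhom hfm hv
  have himg : ∀ T : Set ι, k ∉ T → Function.update f k v '' T = f '' T := fun T hT =>
    Set.image_congr fun i hi => Function.update_of_ne (ne_of_mem_of_not_mem hi hT) _ _
  intro T i hi x hx
  by_cases hkT : k ∈ T
  · have hik : i ≠ k := fun h => hi (h ▸ hkT)
    have hT : T = insert k (T \ {k}) := by simp [Set.insert_eq_of_mem hkT]
    have hk' : k ∉ T \ {k} := by simp
    have hi' : i ∉ T \ {k} := fun h => hi h.1
    rw [hT, Set.image_insert_eq, himg _ hk', Function.update_self] at hx ⊢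
    rw [Function.update_of_ne hik] at hx
    obtain ⟨y, t, ht, hxy⟩ := Ideal.mem_span_insert.1 hx
    have hy : y ∈ Ideal.span (f '' insert i (T \ {k})) := by
      refine hreg _ (by simp [hik.symm]) y ?_
      rw [Set.image_insert_eq, Ideal.mem_span_insert]
      exact ⟨x, -t, neg_mem ht, by linear_combination -hxy⟩
    rw [Set.image_insert_eq] at hy
    obtain ⟨w, t', ht', rfl⟩ := Ideal.mem_span_insert.1 hy
    refine Ideal.mem_span_insert.2 ⟨w, x - w * v, hf _ i hi' _ ?_, by ring⟩
    have := add_mem (Ideal.mul_mem_left _ v ht') ht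
    convert this using 1
    linear_combination hxy
  · rw [himg _ hkT] at hx ⊢
    by_cases hik : i = k
    · subst hik
      rw [Function.update_self] at hx
      exact hreg T hkT x hx
    · rw [Function.update_of_ne hik] at hx
      exact hf T i hi x hx

lemma isStronglyRegular_X : IsStronglyRegular (X : σ → MvPolynomial σ K) := by
  classical
  intro T i hi x hx
  rw [mem_ideal_span_X_image] at hx ⊢
  intro m hm
  obtain ⟨j, hj, hmj⟩ := hx (m + Finsupp.single i 1) (by
    rw [MvPolynomial.mem_support_iff, mul_comm, coeff_mul_X]
    exact MvPolynomial.mem_support_iff.1 hm)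
  refine ⟨j, hj, ?_⟩
  have hji : i ≠ j := fun h => hi (h ▸ hj)
  simpa [Finsupp.single_apply, hji] using hmj

/-! ### One-dimensional socles -/

/-- The socle of the quotient by `I` is spanned by the class of a form of degree `s`. -/
def HasSimpleSocle (I : Ideal (MvPolynomial σ K)) (s : ℕ) : Prop :=
  ∃ τ : MvPolynomial σ K, τ.IsHomogeneous s ∧ τ ∉ I ∧ (∀ i, X i * τ ∈ I) ∧
    ∀ x, (∀ i, X i * x ∈ I) → ∃ c : K, x - C c * τ ∈ I

/-- In a one-dimensional Cohen-Macaulay graded ring, the socles of the quotients by two regular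
elements `u` and `v` correspond to each other via `t = (v / u) * s`. -/
lemma HasSimpleSocle.exchange {s : Set (MvPolynomial σ K)}
    (hs : ∀ p ∈ s, ∃ n, p.IsHomogeneous n) {u v : MvPolynomial σ K} {d e : ℕ}
    (hu : u.IsHomogeneous d) (hv : v.IsHomogeneous (d + e)) (hd : 1 ≤ d)
    (hureg : ∀ x, u * x ∈ Ideal.span s → x ∈ Ideal.span s)
    (hvreg : ∀ x, v * x ∈ Ideal.span s → x ∈ Ideal.span s) {m : ℕ}
    (h : HasSimpleSocle (Ideal.span (insert u s)) m) :
    HasSimpleSocle (Ideal.span (insert v s)) (m + e) := by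
  obtain ⟨τ, hτ, hτI, hXτ, huniq⟩ := h
  have hum : u ∈ idealOfVars σ K := by simpa using hu.mem_idealOfVars_pow hd
  have hvm : v ∈ idealOfVars σ K := by simpa using hv.mem_idealOfVars_pow (k := 1) (by omega)
  obtain ⟨ρ, z, hz, hρ⟩ := Ideal.mem_span_insert.1 (mul_mem_of_mem_idealOfVars hXτ hvm)
  set t := homogeneousComponent (m + e) ρ
  have hvt : v * τ - u * t ∈ Ideal.span s := by
    have h1 := homogeneousComponent_mem_span hs hz (d + (m + e))
    have h2 : z = v * τ - u * ρ := by linear_combination -hρ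
    rw [h2, map_sub, homogeneousComponent_mul_of_isHomogeneous_s1 hu,
      homogeneousComponent_eq_self (by convert hv.mul hτ using 1; omega)] at h1
    exact h1
  have mem_iff : ∀ {w x : MvPolynomial σ K},
      x ∈ Ideal.span (insert w s) ↔ ∃ y, x - w * y ∈ Ideal.span s := by
    intro w x
    rw [Ideal.mem_span_insert]
    constructor
    · rintro ⟨a, z, hz, rfl⟩
      exact ⟨a, by convert hz using 1; ring⟩
    · rintro ⟨y, hy⟩
      exact ⟨y, _, hy, by ring⟩
  refine ⟨t, homogeneousComponent_isHomogeneous _ _, fun htI => hτI ?_, fun i => ?_, fun x hx => ?_⟩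
  · obtain ⟨y, hy⟩ := mem_iff.1 htI
    refine mem_iff.2 ⟨y, hvreg _ ?_⟩
    convert add_mem hvt (Ideal.mul_mem_left _ u hy) using 1
    ring
  · obtain ⟨y, hy⟩ := mem_iff.1 (hXτ i)
    refine mem_iff.2 ⟨y, hureg _ ?_⟩
    convert sub_mem (Ideal.mul_mem_left _ v hy) (Ideal.mul_mem_left _ (X i) hvt) using 1
    ring
  · obtain ⟨y, hy⟩ := mem_iff.1 (mul_mem_of_mem_idealOfVars hx hum)
    obtain ⟨c, hc⟩ := huniq y fun i => by
      obtain ⟨w, hw⟩ := mem_iff.1 (hx i)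
      refine mem_iff.2 ⟨w, hvreg _ ?_⟩
      convert sub_mem (Ideal.mul_mem_left _ u hw) (Ideal.mul_mem_left _ (X i) hy) using 1
      ring
    obtain ⟨w, hw⟩ := mem_iff.1 hc
    refine ⟨c, mem_iff.2 ⟨w, hureg _ ?_⟩⟩
    convert add_mem (add_mem hy (Ideal.mul_mem_left _ v hw))
      (Ideal.mul_mem_left _ (C c) hvt) using 1
    ring

lemma hasSimpleSocle_span_X :
    HasSimpleSocle (Ideal.span (Set.range (X : σ → MvPolynomial σ K))) 0 := by
  have hmem : ∀ p : MvPolynomial σ K, p ∈ idealOfVars σ K ↔ coeff 0 p = 0 := by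
    intro p
    rw [← pow_one (idealOfVars σ K), mem_pow_idealOfVars_iff']
    constructor
    · intro h; exact h 0 (by simp)
    · intro h x hx
      obtain rfl : x = 0 := by simpa [Finsupp.degree_eq_zero_iff] using hx
      exact h
  refine ⟨1, isHomogeneous_one _ _, ?_, fun i => ?_, fun x _ => ⟨coeff 0 x, ?_⟩⟩
  · rw [hmem]; simp
  · rw [hmem]; simp
  · rw [hmem]; simp

/-- Exchanging the variables one at a time for general members of a system of parameters of
degree `e + 1`. -/
lemma exists_stronglyRegular_of_pow_mem [Infinite K] [Finite σ] {V : Submodule K (MvPolynomial σ K)}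
    {e : ℕ} (hV : ∀ p ∈ V, p.IsHomogeneous (1 + e)) {N : ℕ}
    (hN : ∀ i, (X i : MvPolynomial σ K) ^ N ∈ Ideal.span (V : Set (MvPolynomial σ K)))
    (U : Finset σ) :
    ∃ g : σ → MvPolynomial σ K, (∀ i ∈ U, g i ∈ V) ∧ (∀ i ∉ U, g i = X i) ∧
      IsStronglyRegular g ∧ HasSimpleSocle (Ideal.span (Set.range g)) (U.card * e) := by
  classical
  induction U using Finset.induction_on with
  | empty => exact ⟨X, by simp, by simp, isStronglyRegular_X, by simpa using hasSimpleSocle_span_X⟩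
  | @insert k U hk ih =>
    obtain ⟨g, hgV, hgX, hg, hsoc⟩ := ih
    have hhom : ∀ i, ∃ n, 1 ≤ n ∧ (g i).IsHomogeneous n := fun i => by
      by_cases hi : i ∈ U
      · exact ⟨1 + e, by omega, hV _ (hgV i hi)⟩
      · exact ⟨1, le_rfl, hgX i hi ▸ isHomogeneous_X _ _⟩
    have hgm : ∀ i, g i ∈ idealOfVars σ K := fun i => by
      obtain ⟨n, hn, h⟩ := hhom i
      simpa using h.mem_idealOfVars_pow hn
    have hureg := hg {k}ᶜ k (by simp)
    obtain ⟨v, hvV, hvreg⟩ := exists_mem_regular_mod (u := g k) hureg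
      (hgX k hk ▸ hN k)
    have hrange : ∀ h : σ → MvPolynomial σ K, Set.range h = insert (h k) (h '' {k}ᶜ) := fun h => by
      rw [← Set.image_insert_eq, ← Set.image_univ]
      congr 1; ext i; simp [em]
    refine ⟨Function.update g k v, fun i hi => ?_, fun i hi => ?_,
      hg.update (fun i => (hhom i).imp fun _ h => h.2) hgm hvreg, ?_⟩
    · by_cases hik : i = k
      · subst hik; simpa using hvV
      · rw [Function.update_of_ne hik]
        exact hgV i ((Finset.mem_insert.1 hi).resolve_left hik)
    · rw [Finset.mem_insert, not_or] at hi
      rw [Function.update_of_ne hi.1, hgX i hi.2]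
    · have himg : Function.update g k v '' {k}ᶜ = g '' {k}ᶜ :=
        Set.image_congr fun i hi => Function.update_of_ne hi _ _
      rw [hrange, Function.update_self, himg, Finset.card_insert_of_notMem hk, add_mul, one_mul]
      rw [hrange] at hsoc
      refine hsoc.exchange ?_ (hgX k hk ▸ isHomogeneous_X _ _) (hV v hvV) le_rfl hureg hvreg
      rintro _ ⟨i, _, rfl⟩
      exact (hhom i).imp fun _ h => h.2

lemma IsStronglyRegular.linearIndependent {ι : Type*} {g : ι → MvPolynomial σ K}
    (hg : IsStronglyRegular g) (hgm : ∀ i, g i ∈ idealOfVars σ K) : LinearIndependent K g := by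
  rw [linearIndependent_iff_notMem_span]
  intro i hi
  have hi' : g i * 1 ∈ Ideal.span (g '' {i}ᶜ) := by
    rw [mul_one]
    rw [Set.compl_eq_univ_sdiff]
    exact Submodule.span_le_restrictScalars K _ _ hi
  have h1 := hg {i}ᶜ i (by simp) 1 hi'
  have hle : Ideal.span (g '' {i}ᶜ) ≤ idealOfVars σ K := by
    refine Ideal.span_le.2 ?_
    rintro _ ⟨j, _, rfl⟩
    exact hgm j
  have := (C_mem_pow_idealOfVars_iff (σ := σ) (R := K) 1 1).1 (by simpa using hle h1)
  simp at this

/-- Macaulay: `card σ` forms of degree `1 + e` without common zeros define an ideal whose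
quotient has one-dimensional socle in degree `card σ * e`. -/
lemma hasSimpleSocle_of_pow_mem [Infinite K] [Fintype σ] {f : σ → MvPolynomial σ K} {e : ℕ}
    (hf : ∀ i, (f i).IsHomogeneous (1 + e)) {N : ℕ}
    (hN : ∀ i, (X i : MvPolynomial σ K) ^ N ∈ Ideal.span (Set.range f)) :
    HasSimpleSocle (Ideal.span (Set.range f)) (Fintype.card σ * e) := by
  set V := Submodule.span K (Set.range f) with hVdef
  have hV : ∀ p ∈ V, p.IsHomogeneous (1 + e) := by
    have : V ≤ homogeneousSubmodule σ K (1 + e) := by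
      refine Submodule.span_le.2 ?_
      rintro _ ⟨i, rfl⟩
      exact hf i
    exact this
  have hspan : Ideal.span (V : Set (MvPolynomial σ K)) = Ideal.span (Set.range f) :=
    Submodule.span_span_of_tower K _ _
  obtain ⟨g, hgV, -, hg, hsoc⟩ := exists_stronglyRegular_of_pow_mem (N := N) hV
    (by rwa [hspan]) Finset.univ
  have hgV' : Set.range g ⊆ V := by
    rintro _ ⟨i, rfl⟩
    exact hgV i (Finset.mem_univ i)
  have hli := hg.linearIndependent fun i => by
    simpa using (hV _ (hgV i (Finset.mem_univ i))).mem_idealOfVars_pow (k := 1) (by omega)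
  have : FiniteDimensional K V := FiniteDimensional.span_of_finite K (Set.finite_range f)
  have hVg : Submodule.span K (Set.range g) = V := by
    refine Submodule.eq_of_le_of_finrank_le (Submodule.span_le.2 hgV') ?_
    rw [finrank_span_eq_card hli]
    exact finrank_range_le_card f
  have hgf : Ideal.span (Set.range g) = Ideal.span (Set.range f) := by
    rw [← hspan, ← hVg]
    exact (Submodule.span_span_of_tower K _ _).symm
  rwa [hgf] at hsoc

/-- If the quotient by a homogeneous ideal has finite length and simple socle in degree `n`, then
every nonzero class of degree `d` has a nonzero multiple in degree `n`. -/
lemma HasSimpleSocle.exists_mul_notMem {s : Set (MvPolynomial σ K)}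
    (hs : ∀ p ∈ s, ∃ n, p.IsHomogeneous n) {n M : ℕ} (h : HasSimpleSocle (Ideal.span s) n)
    (hM : idealOfVars σ K ^ M ≤ Ideal.span s) {d : ℕ} {a : MvPolynomial σ K}
    (ha : a.IsHomogeneous d) (haI : a ∉ Ideal.span s) :
    d ≤ n ∧ ∃ b : MvPolynomial σ K, b.IsHomogeneous (n - d) ∧ a * b ∉ Ideal.span s := by
  obtain ⟨τ, hτ, hτI, hXτ, huniq⟩ := h
  have hdM : d < M := by
    by_contra! hle
    exact haI (hM (ha.mem_idealOfVars_pow hle))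
  induction hk : M - d generalizing d a with
  | zero => omega
  | succ k ih =>
    by_cases hsoc : ∀ i, X i * a ∈ Ideal.span s
    · obtain ⟨c, hc⟩ := huniq a hsoc
      have hdn : d = n := by
        by_contra hne
        have h1 := homogeneousComponent_mem_span hs hc d
        rw [map_sub, homogeneousComponent_C_mul, homogeneousComponent_eq_self ha,
          homogeneousComponent_of_mem hτ, if_neg hne, mul_zero, sub_zero] at h1
        exact haI h1
      subst hdn
      exact ⟨le_rfl, 1, by simpa using isHomogeneous_one σ K, by simpa using haI⟩
    · push Not at hsoc
      obtain ⟨i, hi⟩ := hsoc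
      have hXa : (X i * a).IsHomogeneous (d + 1) := by
        rw [add_comm]; exact (isHomogeneous_X K i).mul ha
      have hd' : d + 1 < M := by
        by_contra! hle
        exact hi (hM (hXa.mem_idealOfVars_pow hle))
      obtain ⟨hle, b, hb, hab⟩ := ih hXa hi hd' (by omega)
      refine ⟨by omega, X i * b, ?_, ?_⟩
      · convert (isHomogeneous_X K i).mul hb using 1; omega
      · convert hab using 2; ring

end Graded

/-! ### The Jacobian ideal -/

lemma IsSmoothCubic.isHomogeneous_pderiv {E : MvPolynomial (Fin 5) ℂ} (hE : IsSmoothCubic E)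
    (i : Fin 5) : (pderiv i E).IsHomogeneous 2 :=
  hE.1.pderiv

lemma IsSmoothCubic.exists_idealOfVars_pow_le {E : MvPolynomial (Fin 5) ℂ}
    (hE : IsSmoothCubic E) : ∃ M, idealOfVars (Fin 5) ℂ ^ M ≤ jacobianIdeal E := by
  refine Ideal.exists_pow_le_of_le_radical_of_fg ?_ (idealOfVars_fg _ _)
  rw [← vanishingIdeal_zeroLocus_eq_radical (K := ℂ)]
  refine Ideal.span_le.2 ?_
  rintro _ ⟨i, rfl⟩
  rw [SetLike.mem_coe, mem_vanishingIdeal_iff]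
  intro x hx
  have : x = 0 := hE.2 x fun j => by
    simpa [aeval_eq_eval] using hx _ (Ideal.subset_span ⟨j, rfl⟩)
  simp [this]

lemma IsSmoothCubic.hasSimpleSocle {E : MvPolynomial (Fin 5) ℂ} (hE : IsSmoothCubic E) :
    HasSimpleSocle (jacobianIdeal E) 5 := by
  obtain ⟨M, hM⟩ := hE.exists_idealOfVars_pow_le
  simpa [jacobianIdeal] using hasSimpleSocle_of_pow_mem (e := 1) (N := M) hE.isHomogeneous_pderiv
    fun i => hM (Ideal.pow_mem_pow (Ideal.subset_span (Set.mem_range_self i)) M)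

lemma IsSmoothCubic.exists_mul_notMem {E : MvPolynomial (Fin 5) ℂ} (hE : IsSmoothCubic E)
    {d : ℕ} {a : MvPolynomial (Fin 5) ℂ} (ha : a.IsHomogeneous d) (haJ : a ∉ jacobianIdeal E) :
    d ≤ 5 ∧ ∃ b : MvPolynomial (Fin 5) ℂ, b.IsHomogeneous (5 - d) ∧ a * b ∉ jacobianIdeal E := by
  obtain ⟨M, hM⟩ := hE.exists_idealOfVars_pow_le
  refine HasSimpleSocle.exists_mul_notMem ?_ hE.hasSimpleSocle hM ha haJ
  rintro _ ⟨i, rfl⟩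
  exact ⟨2, hE.isHomogeneous_pderiv i⟩

lemma IsSmoothCubic.finrank_Rpiece_five {E : MvPolynomial (Fin 5) ℂ} (hE : IsSmoothCubic E) :
    finrank ℂ (Rpiece E 5) = 1 := by
  obtain ⟨τ, hτ, hτJ, hXτ, huniq⟩ := hE.hasSimpleSocle
  rw [finrank_eq_one_iff']
  refine ⟨⟨Submodule.mkQ _ τ, Submodule.mem_map_of_mem hτ⟩, ?_, ?_⟩
  · rw [Ne, Subtype.ext_iff]
    simpa using hτJ
  · rintro ⟨_, a, ha, rfl⟩
    obtain ⟨c, hc⟩ := huniq a fun i => by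
      by_contra hi
      have := (hE.exists_mul_notMem ((isHomogeneous_X ℂ i).mul ha) hi).1
      omega
    refine ⟨c, Subtype.ext ?_⟩
    refine ((Submodule.Quotient.eq _).2 ?_).symm
    simpa [smul_eq_C_mul] using hc

/-- The multiplication pairing `R^i × R^{5-i} → R^5` is perfect: `R^5` is one-dimensional,
every class of `R^i` nonzero in the Jacobian ring (i.e. a homogeneous polynomial of degree `i`
not in `J`) pairs nontrivially with some class of `R^{5-i}`, and symmetrically. -/
theorem statement1 (E : MvPolynomial (Fin 5) ℂ) (hE : IsSmoothCubic E)
    (i : ℕ) (hi : i ≤ 5) :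
    finrank ℂ (Rpiece E 5) = 1 ∧
    (∀ a : MvPolynomial (Fin 5) ℂ, a.IsHomogeneous i → a ∉ jacobianIdeal E →
      ∃ b : MvPolynomial (Fin 5) ℂ, b.IsHomogeneous (5 - i) ∧ a * b ∉ jacobianIdeal E) ∧
    (∀ b : MvPolynomial (Fin 5) ℂ, b.IsHomogeneous (5 - i) → b ∉ jacobianIdeal E →
      ∃ a : MvPolynomial (Fin 5) ℂ, a.IsHomogeneous i ∧ a * b ∉ jacobianIdeal E) := by
  refine ⟨hE.finrank_Rpiece_five, fun a ha haJ => (hE.exists_mul_notMem ha haJ).2,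
    fun b hb hbJ => ?_⟩
  obtain ⟨-, a, ha, hab⟩ := hE.exists_mul_notMem hb hbJ
  exact ⟨a, by convert ha using 1; omega, by rwa [mul_comm]⟩
end
end

section
/- Let E be a smooth homogeneous cubic in S = ℂ[z₀,…,z₄] with Jacobian ideal J. For every ξ ∈ S^3 with ξ ∉ J, the subspace K₁(ξ) = {η ∈ S^1 : η·ξ ∈ J} of the 5-dimensional space S^1 has dimension at most 3. (Equivalently, the multiplication map δ(ξ): R^1 → R^4 induced by ξ on the Jacobian ring has rank at least 2.) -/
open MvPolynomial Module

noncomputable section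

/-- `K₁(ξ) = {η ∈ S^1 : η·ξ ∈ J}`, the space of linear forms killed by multiplication
by `ξ` in the Jacobian ring. -/
def K1 (E ξ : MvPolynomial (Fin 5) ℂ) : Submodule ℂ (MvPolynomial (Fin 5) ℂ) :=
  homogeneousSubmodule (Fin 5) ℂ 1 ⊓
    Submodule.comap (LinearMap.mulRight ℂ ξ) ((jacobianIdeal E).restrictScalars ℂ)

section CompleteIntersection

variable {σ K : Type*} [Field K]

section Homogeneous

attribute [local instance] MvPolynomial.gradedAlgebra

theorem coe_decompose_eq_homogeneousComponent (f : MvPolynomial σ K) (n : ℕ) :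
    (DirectSum.decompose (homogeneousSubmodule σ K) f n : MvPolynomial σ K) =
      homogeneousComponent n f :=
  decomposition.decompose'_apply f n

theorem homogeneousComponent_mul_of_le {a : MvPolynomial σ K} {d n : ℕ} (ha : a.IsHomogeneous d)
    (h : d ≤ n) (b : MvPolynomial σ K) :
    homogeneousComponent n (a * b) = a * homogeneousComponent (n - d) b := by
  simp only [← coe_decompose_eq_homogeneousComponent]
  exact DirectSum.coe_decompose_mul_of_left_mem_of_le _ ha h

theorem homogeneousComponent_mul_of_lt {a : MvPolynomial σ K} {d n : ℕ} (ha : a.IsHomogeneous d)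
    (h : n < d) (b : MvPolynomial σ K) :
    homogeneousComponent n (a * b) = 0 := by
  rw [← coe_decompose_eq_homogeneousComponent]
  exact DirectSum.coe_decompose_mul_of_left_mem_of_not_le _ ha (by omega)

/-- An ideal containing all homogeneous components of its elements. -/
def ContainsComponents (I : Ideal (MvPolynomial σ K)) : Prop :=
  ∀ p ∈ I, ∀ n, homogeneousComponent n p ∈ I

theorem containsComponents_span {s : Set (MvPolynomial σ K)}
    (hs : ∀ p ∈ s, ∃ d, p.IsHomogeneous d) : ContainsComponents (Ideal.span s) :=
  fun _ hp n => homogeneousComponent_mem_of_mem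
    (Ideal.homogeneous_span (homogeneousSubmodule σ K) s hs) hp n

end Homogeneous

/-- A homogeneous element of `I + (y)` is congruent modulo `I` to a multiple of `y` by a
homogeneous element of the complementary degree. -/
theorem ContainsComponents.exists_homogeneous_sub_mul_mem {I : Ideal (MvPolynomial σ K)}
    (hI : ContainsComponents I) {f y : MvPolynomial σ K} {e d : ℕ} (hf : f.IsHomogeneous e)
    (hy : y.IsHomogeneous d) (h : f ∈ I ⊔ Ideal.span {y}) :
    ∃ v, v.IsHomogeneous (e - d) ∧ (e < d → v = 0) ∧ f - y * v ∈ I := by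
  obtain ⟨i, hi, z, hz, rfl⟩ := Submodule.mem_sup.mp h
  obtain ⟨v, rfl⟩ := Ideal.mem_span_singleton'.mp hz
  have key := homogeneousComponent_eq_self hf
  rw [map_add, mul_comm v y] at key
  rcases le_or_gt d e with hde | hde
  · refine ⟨homogeneousComponent (e - d) v, homogeneousComponent_isHomogeneous _ _,
      fun h => absurd h (by omega), ?_⟩
    rw [homogeneousComponent_mul_of_le hy hde] at key
    rw [mul_comm v y, ← key, add_sub_cancel_right]
    exact hI i hi e
  · refine ⟨0, isHomogeneous_zero _ _ _, fun _ => rfl, ?_⟩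
    rw [homogeneousComponent_mul_of_lt hy hde] at key
    rw [mul_comm v y, ← key, mul_zero, add_zero, sub_zero]
    exact hI i hi e

theorem ContainsComponents.mem_of_forall_mem_sup_span_pow {I : Ideal (MvPolynomial σ K)}
    (hI : ContainsComponents I) {a g : MvPolynomial σ K} {d : ℕ} (ha : a.IsHomogeneous d)
    (hd : 0 < d) (h : ∀ n, g ∈ I ⊔ Ideal.span {a ^ n}) : g ∈ I := by
  rw [← sum_homogeneousComponent g]
  refine Ideal.sum_mem _ fun e _ => ?_
  obtain ⟨i, hi, z, hz, hg⟩ := Submodule.mem_sup.mp (h (e + 1))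
  obtain ⟨v, rfl⟩ := Ideal.mem_span_singleton'.mp hz
  rw [← hg, map_add, mul_comm v, homogeneousComponent_mul_of_lt (ha.pow (e + 1)) (by nlinarith),
    add_zero]
  exact hI i hi e

/-- If `a` and `b` are regular on `S ⧸ I` and `S ⧸ (I + (a))` respectively, then `b` is regular
on `S ⧸ I`. -/
theorem ContainsComponents.mem_of_mul_mem {I : Ideal (MvPolynomial σ K)}
    (hI : ContainsComponents I) {a b : MvPolynomial σ K} {d : ℕ} (ha : a.IsHomogeneous d)
    (hd : 0 < d) (haI : ∀ g, a * g ∈ I → g ∈ I)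
    (hb : ∀ g, b * g ∈ I ⊔ Ideal.span {a} → g ∈ I ⊔ Ideal.span {a}) {g : MvPolynomial σ K}
    (hg : b * g ∈ I) : g ∈ I := by
  refine hI.mem_of_forall_mem_sup_span_pow ha hd fun n => ?_
  induction n generalizing g with
  | zero => simp
  | succ n ih =>
    obtain ⟨i, hi, z, hz, rfl⟩ := Submodule.mem_sup.mp (hb g (Submodule.mem_sup_left hg))
    obtain ⟨v, rfl⟩ := Ideal.mem_span_singleton'.mp hz
    have hv : b * v ∈ I := by
      refine haI _ ?_
      have := I.sub_mem hg (I.mul_mem_left b hi)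
      convert this using 1
      ring
    obtain ⟨j, hj, z, hz, hv'⟩ := Submodule.mem_sup.mp (ih hv)
    obtain ⟨w, rfl⟩ := Ideal.mem_span_singleton'.mp hz
    refine Submodule.mem_sup.mpr ⟨i + j * a, I.add_mem hi (I.mul_mem_right a hj), w * a ^ (n + 1),
      Ideal.mem_span_singleton'.mpr ⟨w, rfl⟩, ?_⟩
    rw [← hv']
    ring

/-- A family of forms of positive degrees `d i` without common zeros other than the origin. -/
structure IsHomogeneousParameters (c : σ → MvPolynomial σ K) (d : σ → ℕ) : Prop where
  isHomogeneous : ∀ i, (c i).IsHomogeneous (d i)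
  degree_pos : ∀ i, 0 < d i
  eq_zero : ∀ x : σ → K, (∀ i, eval x (c i) = 0) → x = 0

/-- A family in which each member is regular modulo the ideal generated by any set of the other
members. -/
def IsRegularFamily (c : σ → MvPolynomial σ K) : Prop :=
  ∀ (T : Set σ) (i : σ), i ∉ T → ∀ g, c i * g ∈ Ideal.span (c '' T) → g ∈ Ideal.span (c '' T)

/-- The socle of `S ⧸ (c)` vanishes in degrees less than `∑ i, (d i - 1)`. -/
def SocleVanishesBelow [Fintype σ] (c : σ → MvPolynomial σ K) (d : σ → ℕ) : Prop :=
  ∀ (u : MvPolynomial σ K) (e : ℕ), u.IsHomogeneous e → e + Fintype.card σ < ∑ i, d i →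
    (∀ j, X j * u ∈ Ideal.span (Set.range c)) → u ∈ Ideal.span (Set.range c)

theorem isRegularFamily_X : IsRegularFamily (X : σ → MvPolynomial σ K) := by
  classical
  intro T i hi g hg
  rw [mem_ideal_span_X_image] at hg ⊢
  intro m hm
  obtain ⟨j, hj, hjm⟩ := hg (Finsupp.single i 1 + m) (by
    rw [MvPolynomial.mem_support_iff, coeff_X_mul]
    exact MvPolynomial.mem_support_iff.mp hm)
  refine ⟨j, hj, ?_⟩
  have hij : i ≠ j := fun h => hi (h ▸ hj)
  simpa [Finsupp.single_eq_of_ne hij.symm] using hjm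

theorem IsHomogeneousParameters.containsComponents {c : σ → MvPolynomial σ K} {d : σ → ℕ}
    (hc : IsHomogeneousParameters c d) (T : Set σ) :
    ContainsComponents (Ideal.span (c '' T)) := by
  refine containsComponents_span ?_
  rintro _ ⟨i, -, rfl⟩
  exact ⟨d i, hc.isHomogeneous i⟩

theorem span_image_insert (c : σ → MvPolynomial σ K) (T : Set σ) (i : σ) :
    Ideal.span (c '' insert i T) = Ideal.span (c '' T) ⊔ Ideal.span {c i} := by
  rw [Set.image_insert_eq, Ideal.span_insert, sup_comm]

theorem span_range_eq (c : σ → MvPolynomial σ K) (k : σ) :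
    Ideal.span (Set.range c) = Ideal.span (c '' {k}ᶜ) ⊔ Ideal.span {c k} := by
  rw [← span_image_insert, ← Set.image_univ]
  congr 2
  ext i
  simp [em]

theorem eval_zero_of_isHomogeneous {f : MvPolynomial σ K} {d : ℕ} (hf : f.IsHomogeneous d)
    (hd : 0 < d) : eval 0 f = 0 := by
  rw [eval_zero]
  exact hf.coeff_eq_zero (by simpa using hd.ne)

theorem IsHomogeneousParameters.mem_radical [IsAlgClosed K] [Finite σ]
    {c : σ → MvPolynomial σ K} {d : σ → ℕ} (hc : IsHomogeneousParameters c d)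
    {f : MvPolynomial σ K} (hf : eval 0 f = 0) : f ∈ (Ideal.span (Set.range c)).radical := by
  rw [← vanishingIdeal_zeroLocus_eq_radical (K := K), mem_vanishingIdeal_iff]
  intro x hx
  rw [zeroLocus_span] at hx
  have : x = 0 := hc.eq_zero x fun i => by simpa using hx (c i) ⟨i, rfl⟩
  simpa [this] using hf

/-- Regularity is preserved when one member of a family of parameters is replaced. -/
theorem IsRegularFamily.exchange [IsAlgClosed K] [Finite σ] {c c' : σ → MvPolynomial σ K}
    {d d' : σ → ℕ} (hc : IsHomogeneousParameters c d) (hc' : IsHomogeneousParameters c' d') {k : σ}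
    (hcc' : ∀ i ≠ k, c i = c' i) (h : IsRegularFamily c) : IsRegularFamily c' := by
  have himage : ∀ T : Set σ, k ∉ T → c '' T = c' '' T := fun T hT =>
    Set.image_congr fun i hi => hcc' i fun hik => hT (hik ▸ hi)
  have hk : ∀ T : Set σ, k ∉ T → ∀ g, c' k * g ∈ Ideal.span (c' '' T) →
      g ∈ Ideal.span (c' '' T) := by
    intro T
    induction hn : Tᶜ.ncard using Nat.strong_induction_on generalizing T with
    | _ n ih =>
    intro hkT g hg
    by_cases hT : ∃ i, i ∉ T ∧ i ≠ k
    · obtain ⟨i, hi, hik⟩ := hT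
      refine (hc'.containsComponents T).mem_of_mul_mem (hc'.isHomogeneous i) (hc'.degree_pos i)
        (fun g hg => ?_) (fun g hg => ?_) hg
      · rw [← hcc' i hik, ← himage T hkT] at hg
        rw [← himage T hkT]
        exact h T i hi g hg
      · rw [← span_image_insert] at hg ⊢
        refine ih _ ?_ (insert i T) rfl (by simp [hik.symm, hkT]) g hg
        rw [← hn]
        refine Set.ncard_lt_ncard ?_ (Set.toFinite _)
        exact compl_lt_compl_iff_lt.mpr (Set.ssubset_insert hi)
    · have hTk : T = {k}ᶜ := by
        ext i
        simp only [Set.mem_compl_iff, Set.mem_singleton_iff]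
        exact ⟨fun hi hik => hkT (hik ▸ hi), fun hik => by_contra fun hi => hT ⟨i, hi, hik⟩⟩
      obtain ⟨N, hN⟩ := hc'.mem_radical
        (eval_zero_of_isHomogeneous (hc.isHomogeneous k) (hc.degree_pos k))
      rw [span_range_eq c' k, ← hTk] at hN
      obtain ⟨i, hi, z, hz, hsum⟩ := Submodule.mem_sup.mp hN
      obtain ⟨v, rfl⟩ := Ideal.mem_span_singleton'.mp hz
      have hpow : c k ^ N * g ∈ Ideal.span (c' '' T) := by
        rw [← hsum, add_mul, mul_assoc]
        exact Ideal.add_mem _ (Ideal.mul_mem_right _ _ hi) (Ideal.mul_mem_left _ _ hg)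
      clear hN hsum
      induction N with
      | zero => simpa using hpow
      | succ N ihN =>
        refine ihN ?_
        rw [pow_succ', mul_assoc] at hpow
        rw [← himage T hkT] at hpow ⊢
        exact h T k hkT _ hpow
  intro T i hi g hg
  by_cases hik : i = k
  · subst hik
    exact hk T hi g hg
  by_cases hkT : k ∈ T
  · set U := T \ {k} with hU
    have hkU : k ∉ U := by simp [hU]
    have hiU : i ∉ U := fun h => hi h.1
    have hT : T = insert k U := by simp [hU, Set.insert_eq_of_mem hkT]
    rw [hT, span_image_insert] at hg ⊢
    obtain ⟨a, ha, z, hz, hsum⟩ := Submodule.mem_sup.mp hg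
    obtain ⟨v, rfl⟩ := Ideal.mem_span_singleton'.mp hz
    have hv : v ∈ Ideal.span (c' '' insert i U) := by
      refine hk _ (by simp [Ne.symm hik, hkU]) _ ?_
      rw [span_image_insert]
      refine Submodule.mem_sup.mpr ⟨-a, neg_mem ha, g * c' i,
        Ideal.mem_span_singleton'.mpr ⟨g, rfl⟩, ?_⟩
      linear_combination -hsum
    rw [span_image_insert] at hv
    obtain ⟨b, hb, z', hz', rfl⟩ := Submodule.mem_sup.mp hv
    obtain ⟨w, rfl⟩ := Ideal.mem_span_singleton'.mp hz'
    have hgw : g - w * c' k ∈ Ideal.span (c' '' U) := by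
      rw [← himage U hkU]
      refine h U i hiU _ ?_
      rw [himage U hkU, hcc' i hik]
      have : c' i * (g - w * c' k) = a + b * c' k := by linear_combination -hsum
      rw [this]
      exact Ideal.add_mem _ ha (Ideal.mul_mem_right _ _ hb)
    exact Submodule.mem_sup.mpr ⟨_, hgw, w * c' k, Ideal.mem_span_singleton'.mpr ⟨w, rfl⟩, by ring⟩
  · rw [← himage T hkT, ← hcc' i hik] at hg
    rw [← himage T hkT]
    exact h T i hi g hg

/-- Vanishing of the socle in low degrees is preserved when one member of a regular family of
parameters is replaced. -/
theorem SocleVanishesBelow.exchange [IsAlgClosed K] [Fintype σ] {c c' : σ → MvPolynomial σ K}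
    {d d' : σ → ℕ} (hc : IsHomogeneousParameters c d) (hc' : IsHomogeneousParameters c' d') {k : σ}
    (hcc' : ∀ i ≠ k, c i = c' i) (hdd' : ∀ i ≠ k, d i = d' i) (hreg : IsRegularFamily c)
    (h : SocleVanishesBelow c d) : SocleVanishesBelow c' d' := by
  classical
  have hreg' := hreg.exchange hc hc' hcc'
  have himage : c '' {k}ᶜ = c' '' {k}ᶜ := Set.image_congr fun i hi => hcc' i hi
  have hcr := span_range_eq c k
  rw [himage] at hcr
  have hk := hreg {k}ᶜ k (by simp)
  rw [himage] at hk
  have hk' := hreg' {k}ᶜ k (by simp)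
  have hhom := hc'.containsComponents {k}ᶜ
  unfold SocleVanishesBelow at h ⊢
  rw [span_range_eq c' k]
  rw [hcr] at h
  set I := Ideal.span (c' '' {k}ᶜ) with hI
  intro u e hu he hmu
  have hsum : ∑ i, d i + d' k = ∑ i, d' i + d k := by
    rw [← Finset.sum_erase_add _ _ (Finset.mem_univ k),
      ← Finset.sum_erase_add _ d' (Finset.mem_univ k),
      Finset.sum_congr rfl fun i hi => hdd' i (Finset.ne_of_mem_erase hi)]
    ring
  have hlu : c k * u ∈ I ⊔ Ideal.span {c' k} := by
    have hmem : c k ∈ idealOfVars σ K ^ 1 := by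
      rw [mem_pow_idealOfVars_iff']
      intro x hx
      have := hc.degree_pos k
      exact (hc.isHomogeneous k).coeff_eq_zero (by omega)
    rw [pow_one] at hmem
    refine Submodule.span_induction (p := fun a _ => a * u ∈ I ⊔ Ideal.span {c' k}) ?_ ?_ ?_ ?_ hmem
    · rintro _ ⟨j, rfl⟩
      exact hmu j
    · simp
    · intro a b _ _ ha hb
      rw [add_mul]
      exact Ideal.add_mem _ ha hb
    · intro a b _ hb
      rw [smul_eq_mul, mul_assoc]
      exact Ideal.mul_mem_left _ _ hb
  obtain ⟨v, hv, hv0, hlv⟩ := hhom.exists_homogeneous_sub_mul_mem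
    ((hc.isHomogeneous k).mul hu) (hc'.isHomogeneous k) hlu
  have hvmem : v ∈ I ⊔ Ideal.span {c k} := by
    rcases lt_or_ge (d k + e) (d' k) with hlt | hge
    · simp [hv0 hlt]
    refine h v _ hv (by omega) fun j => ?_
    obtain ⟨a, ha, z, hz, hsum⟩ := Submodule.mem_sup.mp (hmu j)
    obtain ⟨w, rfl⟩ := Ideal.mem_span_singleton'.mp hz
    have : X j * v - c k * w ∈ I := by
      refine hk' _ ?_
      have := I.sub_mem (I.mul_mem_left (c k) ha) (I.mul_mem_left (X j) hlv)
      convert this using 1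
      linear_combination -c k * hsum
    exact Submodule.mem_sup.mpr ⟨_, this, w * c k, Ideal.mem_span_singleton'.mpr ⟨w, rfl⟩, by ring⟩
  obtain ⟨b, hb, z, hz, rfl⟩ := Submodule.mem_sup.mp hvmem
  obtain ⟨w, rfl⟩ := Ideal.mem_span_singleton'.mp hz
  have : u - w * c' k ∈ I := by
    refine hk _ ?_
    have := I.add_mem hlv (I.mul_mem_left (c' k) hb)
    convert this using 1
    ring
  exact Submodule.mem_sup.mpr ⟨_, this, w * c' k, Ideal.mem_span_singleton'.mpr ⟨w, rfl⟩, by ring⟩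

/-- The fibre of a family of parameters over a coordinate vector is finite. -/
theorem IsHomogeneousParameters.finite_fibre [IsAlgClosed K] [Finite σ]
    {c : σ → MvPolynomial σ K} {d : σ → ℕ} (hc : IsHomogeneousParameters c d) (k : σ) :
    {x : σ → K | (∀ i ≠ k, eval x (c i) = 0) ∧ eval x (c k) = 1}.Finite := by
  classical
  obtain ⟨N, hN⟩ : ∃ N, idealOfVars σ K ^ N ≤ Ideal.span (Set.range c) := by
    refine Ideal.exists_pow_le_of_le_radical_of_fg (Ideal.span_le.mpr ?_) (idealOfVars_fg σ K)
    rintro _ ⟨j, rfl⟩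
    exact hc.mem_radical (by simp)
  set I := Ideal.span (c '' {k}ᶜ) with hI
  set L := I ⊔ Ideal.span {c k - 1} with hL
  let π := Ideal.Quotient.mkₐ K L
  have hmem : ∀ e (f : MvPolynomial σ K), f.IsHomogeneous e →
      π f ∈ (restrictTotalDegree σ K N).map π.toLinearMap := by
    intro e
    induction e using Nat.strong_induction_on with
    | _ e ih =>
    intro f hf
    rcases le_or_gt e N with he | he
    · exact ⟨f, (mem_restrictTotalDegree σ N f).mpr (hf.totalDegree_le.trans he), rfl⟩
    have hfc : f ∈ Ideal.span (Set.range c) := by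
      refine hN ((mem_pow_idealOfVars_iff' N f).mpr fun x hx => hf.coeff_eq_zero ?_)
      omega
    rw [span_range_eq c k] at hfc
    obtain ⟨v, hv, -, hfv⟩ :=
      (hc.containsComponents {k}ᶜ).exists_homogeneous_sub_mul_mem hf (hc.isHomogeneous k) hfc
    have hπ : π f = π v := by
      refine Ideal.Quotient.eq.mpr (Submodule.mem_sup.mpr ⟨_, hfv, v * (c k - 1),
        Ideal.mem_span_singleton'.mpr ⟨v, rfl⟩, by ring⟩)
    rw [hπ]
    exact ih _ (Nat.sub_lt (by omega) (hc.degree_pos k)) v hv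
  have htop : (restrictTotalDegree σ K N).map π.toLinearMap = ⊤ := by
    refine eq_top_iff.mpr fun y _ => ?_
    obtain ⟨f, rfl⟩ := Ideal.Quotient.mk_surjective y
    change π f ∈ _
    rw [← sum_homogeneousComponent f, map_sum]
    exact Submodule.sum_mem _ fun e _ => hmem e _ (homogeneousComponent_isHomogeneous e f)
  have hfin : Module.Finite K (MvPolynomial σ K ⧸ L) := by
    refine ⟨?_⟩
    rw [← htop]
    exact (Module.Finite.iff_fg.mp inferInstance).map _
  have hroot : ∀ j : σ, ∃ p : Polynomial K, p ≠ 0 ∧ Polynomial.aeval (X j) p ∈ L := by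
    intro j
    obtain ⟨p, hp, hp0⟩ := Algebra.IsIntegral.isIntegral (R := K) (π (X j))
    refine ⟨p, hp.ne_zero, Ideal.Quotient.eq_zero_iff_mem.mp ?_⟩
    change π _ = 0
    rw [← Polynomial.aeval_algHom_apply]
    exact hp0
  choose p hp hpL using hroot
  refine (Set.Finite.pi fun j => (p j).rootSet_finite K).subset fun x hx j _ => ?_
  have hLx : L ≤ RingHom.ker (eval x) := by
    refine sup_le (Ideal.span_le.mpr ?_) (Ideal.span_le.mpr ?_)
    · rintro _ ⟨i, hi, rfl⟩
      exact hx.1 i hi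
    · rintro _ rfl
      simp [RingHom.mem_ker, hx.2]
  have h0 := hLx (hpL j)
  rw [RingHom.mem_ker, ← coe_aeval_eq_eval, RingHom.coe_coe, ← Polynomial.aeval_algHom_apply,
    aeval_X] at h0
  exact (Polynomial.mem_rootSet_of_ne (hp j)).mpr h0

/-- Finitely many nonzero vectors over an infinite field are avoided by some hyperplane. -/
theorem exists_linear_form_eval_ne_zero [Infinite K] [Finite σ] {Z : Set (σ → K)} (hZ : Z.Finite)
    (h0 : ∀ x ∈ Z, x ≠ 0) :
    ∃ l : MvPolynomial σ K, l.IsHomogeneous 1 ∧ ∀ x ∈ Z, eval x l ≠ 0 := by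
  classical
  have := Fintype.ofFinite σ
  let φ := Fintype.equivFin σ
  let q : (σ → K) → Polynomial K := fun x => ∑ i, Polynomial.monomial (φ i) (x i)
  have hq : ∀ x ∈ Z, q x ≠ 0 := by
    intro x hx hqx
    refine h0 x hx (funext fun i => ?_)
    have := congrArg (fun r => Polynomial.coeff r (φ i)) hqx
    simpa [q, Polynomial.finsetSum_coeff, Polynomial.coeff_monomial, Fin.val_inj] using this
  obtain ⟨t, ht⟩ := Polynomial.exists_eval_ne_zero_of_natDegree_lt_card (∏ x ∈ hZ.toFinset, q x)
    (Finset.prod_ne_zero_iff.mpr fun x hx => hq x (hZ.mem_toFinset.mp hx))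
    (Cardinal.natCast_lt_aleph0.trans_le (Cardinal.aleph0_le_mk K))
  refine ⟨∑ i, C (t ^ (φ i : ℕ)) * X i,
    IsHomogeneous.sum _ _ _ fun i _ => isHomogeneous_C_mul_X _ _, fun x hx => ?_⟩
  rw [Polynomial.eval_prod] at ht
  have := Finset.prod_ne_zero_iff.mp ht x (hZ.mem_toFinset.mpr hx)
  simpa [q, Polynomial.eval_finsetSum, mul_comm] using this

theorem aeval_mul_left_of_isHomogeneous {B : Type*} [CommRing B] [Algebra K B]
    {f : MvPolynomial σ K} {e : ℕ} (hf : f.IsHomogeneous e) (s : B) (b : σ → B) :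
    aeval (fun j => s * b j) f = s ^ e * aeval b f := by
  rw [aeval_def, aeval_def, eval₂_eq, eval₂_eq, Finset.mul_sum]
  refine Finset.sum_congr rfl fun m hm => ?_
  simp only [mul_pow, Finset.prod_mul_distrib, Finset.prod_pow_eq_pow_sum]
  rw [hf.degree_eq_sum_deg_support hm]
  ring

theorem eval_smul_of_isHomogeneous {f : MvPolynomial σ K} {e : ℕ} (hf : f.IsHomogeneous e) (s : K)
    (x : σ → K) : eval (s • x) f = s ^ e * eval x f := by
  have := aeval_mul_left_of_isHomogeneous hf s x
  rwa [aeval_eq_eval, aeval_eq_eval] at this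

/-- Replacing one member by a form that vanishes nowhere on the corresponding coordinate fibre. -/
theorem IsHomogeneousParameters.update [IsAlgClosed K] [DecidableEq σ]
    {c : σ → MvPolynomial σ K} {d : σ → ℕ} (hc : IsHomogeneousParameters c d) {k : σ}
    {l : MvPolynomial σ K} {e : ℕ} (hl : l.IsHomogeneous e) (he : 0 < e)
    (h : ∀ x : σ → K, (∀ i ≠ k, eval x (c i) = 0) → eval x (c k) = 1 → eval x l ≠ 0) :
    IsHomogeneousParameters (Function.update c k l) (Function.update d k e) where
  isHomogeneous i := by
    rcases eq_or_ne i k with rfl | hi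
    · simpa using hl
    · simpa [hi] using hc.isHomogeneous i
  degree_pos i := by
    rcases eq_or_ne i k with rfl | hi
    · simpa using he
    · simpa [hi] using hc.degree_pos i
  eq_zero x hx := by
    have hx' : ∀ i ≠ k, eval x (c i) = 0 := fun i hi => by simpa [hi] using hx i
    by_contra hx0
    have hk : eval x (c k) ≠ 0 := fun hk => hx0 <| hc.eq_zero x fun i => by
      rcases eq_or_ne i k with rfl | hi
      exacts [hk, hx' i hi]
    obtain ⟨s, hs⟩ := IsAlgClosed.exists_pow_nat_eq (eval x (c k))⁻¹ (hc.degree_pos k)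
    refine h (s • x) (fun i hi => ?_) ?_ ?_
    · rw [eval_smul_of_isHomogeneous (hc.isHomogeneous i), hx' i hi, mul_zero]
    · rw [eval_smul_of_isHomogeneous (hc.isHomogeneous k), hs, inv_mul_cancel₀ hk]
    · have := hx k
      rw [Function.update_self] at this
      rw [eval_smul_of_isHomogeneous hl, this, mul_zero]

theorem isHomogeneousParameters_X :
    IsHomogeneousParameters (X : σ → MvPolynomial σ K) (fun _ => 1) where
  isHomogeneous := isHomogeneous_X K
  degree_pos _ := one_pos
  eq_zero x hx := funext fun i => by simpa using hx i

/-- Regularity and vanishing of the socle in low degrees pass between any two families of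
parameters, by exchanging single members for linear forms in general position. -/
theorem IsHomogeneousParameters.socleVanishesBelow_of_forall_notMem [IsAlgClosed K] [Fintype σ]
    (A : Finset σ) {c c' : σ → MvPolynomial σ K} {d d' : σ → ℕ}
    (hc : IsHomogeneousParameters c d) (hc' : IsHomogeneousParameters c' d')
    (hA : ∀ i ∉ A, c i = c' i ∧ d i = d' i) (hreg : IsRegularFamily c)
    (h : SocleVanishesBelow c d) : IsRegularFamily c' ∧ SocleVanishesBelow c' d' := by
  classical
  induction A using Finset.induction_on generalizing c c' d d' with
  | empty =>
    obtain rfl : c = c' := funext fun i => (hA i (by simp)).1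
    obtain rfl : d = d' := funext fun i => (hA i (by simp)).2
    exact ⟨hreg, h⟩
  | insert k A hk ih =>
    obtain ⟨l, hl, hlne⟩ := exists_linear_form_eval_ne_zero
      ((hc.finite_fibre k).union (hc'.finite_fibre k)) (by
        rintro x (hx | hx) rfl
        · exact zero_ne_one
            ((eval_zero_of_isHomogeneous (hc.isHomogeneous k) (hc.degree_pos k)).symm.trans hx.2)
        · exact zero_ne_one
            ((eval_zero_of_isHomogeneous (hc'.isHomogeneous k) (hc'.degree_pos k)).symm.trans hx.2))
    have hu := hc.update hl one_pos fun x h h' => hlne x (Or.inl ⟨h, h'⟩)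
    have hu' := hc'.update hl one_pos fun x h h' => hlne x (Or.inr ⟨h, h'⟩)
    obtain ⟨hreg₁, h₁⟩ := ih hu hu' (fun i hi => by
        rcases eq_or_ne i k with rfl | hik
        · simp
        · simpa [hik] using hA i (by simp [hik, hi]))
      (hreg.exchange (k := k) hc hu fun i hi => by simp [hi])
      (h.exchange (k := k) hc hu (fun i hi => by simp [hi]) (fun i hi => by simp [hi]) hreg)
    exact ⟨hreg₁.exchange (k := k) hu' hc' fun i hi => by simp [hi],
      h₁.exchange (k := k) hu' hc' (fun i hi => by simp [hi]) (fun i hi => by simp [hi]) hreg₁⟩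

/-- The socle of a graded complete intersection of dimension zero vanishes in low degrees. -/
theorem IsHomogeneousParameters.socleVanishesBelow [IsAlgClosed K] [Fintype σ]
    {c : σ → MvPolynomial σ K} {d : σ → ℕ} (hc : IsHomogeneousParameters c d) :
    SocleVanishesBelow c d :=
  (isHomogeneousParameters_X.socleVanishesBelow_of_forall_notMem Finset.univ hc (by simp)
    isRegularFamily_X fun u e _ he => by simp at he).2

/-- If each variable is congruent to a multiple of `t` modulo `I`, then each form is congruent to a
multiple of a power of `t`. -/
theorem sub_C_eval_mul_pow_mem {I : Ideal (MvPolynomial σ K)} {t : MvPolynomial σ K} {a : σ → K}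
    (h : ∀ j, X j - C (a j) * t ∈ I) {f : MvPolynomial σ K} {e : ℕ} (hf : f.IsHomogeneous e) :
    f - C (eval a f) * t ^ e ∈ I := by
  have hX : Ideal.Quotient.mkₐ K I = (Ideal.Quotient.mkₐ K I).comp (aeval fun j => C (a j) * t) :=
    algHom_ext fun j => by
      simpa using Ideal.Quotient.eq.mpr (h j)
  have hsub : aeval (fun j => C (a j) * t) f = C (eval a f) * t ^ e := by
    simp_rw [mul_comm (C _) t, aeval_mul_left_of_isHomogeneous hf]
    rw [mul_comm, ← algebraMap_eq, ← aeval_eq_eval, ← aeval_algebraMap_apply]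
    rfl
  have := DFunLike.congr_fun hX f
  rw [AlgHom.comp_apply, hsub] at this
  exact Ideal.Quotient.eq.mp this

end CompleteIntersection

theorem IsSmoothCubic.isHomogeneousParameters {E : MvPolynomial (Fin 5) ℂ} (hE : IsSmoothCubic E) :
    IsHomogeneousParameters (fun i => pderiv i E) fun _ => 2 where
  isHomogeneous _ := hE.1.pderiv
  degree_pos _ := two_pos
  eq_zero := hE.2

/-- The Jacobian ring of a smooth cubic in five variables has no socle in degrees below five. -/
theorem IsSmoothCubic.mem_jacobianIdeal {E : MvPolynomial (Fin 5) ℂ} (hE : IsSmoothCubic E)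
    {u : MvPolynomial (Fin 5) ℂ} {e : ℕ} (hu : u.IsHomogeneous e) (he : e < 5)
    (h : ∀ j, X j * u ∈ jacobianIdeal E) : u ∈ jacobianIdeal E :=
  hE.isHomogeneousParameters.socleVanishesBelow u e hu (by simp; omega) h

/-- A space of linear forms of codimension at most one contains all variables up to multiples of
one linear form. -/
theorem exists_X_sub_C_mul_mem {n : ℕ} {W : Submodule ℂ (MvPolynomial (Fin (n + 1)) ℂ)}
    (hW : W ≤ homogeneousSubmodule (Fin (n + 1)) ℂ 1) (hn : n ≤ finrank ℂ W) :
    ∃ (t : MvPolynomial (Fin (n + 1)) ℂ) (a : Fin (n + 1) → ℂ), t.IsHomogeneous 1 ∧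
      ∀ j, X j - C (a j) * t ∈ W := by
  set L := homogeneousSubmodule (Fin (n + 1)) ℂ 1 with hL
  have hspan : L = Submodule.span ℂ (Set.range X) := homogeneousSubmodule_one_eq_span_X
  have hfin : Module.Finite ℂ L := by
    rw [hspan]
    exact Module.Finite.span_of_finite ℂ (Set.finite_range _)
  have hLn : finrank ℂ L ≤ n + 1 := by
    rw [hspan]
    simpa [Set.finrank] using finrank_range_le_card (R := ℂ) (X : Fin (n + 1) → MvPolynomial (Fin (n + 1)) ℂ)
  have hquot : finrank ℂ (L ⧸ W.submoduleOf L) ≤ 1 := by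
    have h1 := (W.submoduleOf L).finrank_quotient_add_finrank
    rw [(Submodule.submoduleOfEquivOfLe hW).finrank_eq] at h1
    omega
  obtain ⟨v, hv⟩ := finrank_le_one_iff.mp hquot
  obtain ⟨⟨t, ht⟩, rfl⟩ := Submodule.Quotient.mk_surjective _ v
  choose a ha using fun j => hv (Submodule.Quotient.mk ⟨X j, isHomogeneous_X ℂ j⟩)
  refine ⟨t, a, ht, fun j => ?_⟩
  have := (Submodule.Quotient.eq _).mp (ha j).symm
  rw [C_mul']
  exact this

/-- For a smooth cubic `E` and `ξ ∈ S³ \ J`, the kernel `K₁(ξ)` of multiplication by `ξ`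
on linear forms has dimension at most 3 (equivalently, `δ(ξ) : R¹ → R⁴` has rank ≥ 2). -/
theorem statement2 (E : MvPolynomial (Fin 5) ℂ) (hE : IsSmoothCubic E)
    (ξ : MvPolynomial (Fin 5) ℂ) (hξ3 : ξ.IsHomogeneous 3) (hξ : ξ ∉ jacobianIdeal E) :
    finrank ℂ (K1 E ξ) ≤ 3 := by
  set J := jacobianIdeal E with hJ
  by_contra! hlt
  obtain ⟨t, a, ht, hta⟩ := exists_X_sub_C_mul_mem (n := 4) (W := K1 E ξ) inf_le_left hlt
  let I : Ideal (MvPolynomial (Fin 5) ℂ) := Submodule.comap (LinearMap.mulRight _ ξ) J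
  have hXI : ∀ j, X j - C (a j) * t ∈ I := fun j => (hta j).2
  have hX : ∀ j, X j * ξ - C (a j) * (t * ξ) ∈ J := fun j => by
    have : (X j - C (a j) * t) * ξ ∈ J := hXI j
    convert this using 1
    ring
  have htξ : t * ξ ∉ J := fun htξ => hξ <| hE.mem_jacobianIdeal hξ3 (by norm_num) fun j =>
    by simpa using J.add_mem (hX j) (J.mul_mem_left (C (a j)) htξ)
  have httξ : t ^ 2 * ξ ∉ J := fun httξ => htξ <|
    hE.mem_jacobianIdeal (ht.mul hξ3) (by norm_num) fun j => by
      have := J.add_mem (J.mul_mem_left t (hX j)) (J.mul_mem_left (C (a j)) httξ)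
      convert this using 1
      ring
  have ha : a = 0 := by
    refine hE.2 a fun i => by_contra fun hne => httξ ?_
    have hi : (pderiv i E - C (eval a (pderiv i E)) * t ^ 2) * ξ ∈ J :=
      sub_C_eval_mul_pow_mem hXI (hE.isHomogeneousParameters.isHomogeneous i)
    have hi' : pderiv i E * ξ ∈ J := J.mul_mem_right ξ (Ideal.subset_span ⟨i, rfl⟩)
    have := J.mul_mem_left (C (eval a (pderiv i E))⁻¹) (J.sub_mem hi' hi)
    convert this using 1
    have hC : C (σ := Fin 5) (eval a (pderiv i E))⁻¹ * C (eval a (pderiv i E)) = 1 := by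
      rw [← C_mul, inv_mul_cancel₀ hne, C_1]
    linear_combination -(t ^ 2 * ξ) * hC
  exact hξ <| hE.mem_jacobianIdeal hξ3 (by norm_num) fun j => by simpa [ha] using hX j
end
end

section
/- Let E be a smooth homogeneous cubic in S = ℂ[z₀,…,z₄] with Jacobian ideal J. Then for every line l ⊆ ℂ^5, the space J_2|_l of restrictions to l of elements of the degree-2 part J_2 of the Jacobian ideal has dimension at least 2. -/
open MvPolynomial Module

noncomputable section

/-- Restriction of polynomials to (the points of) a subspace `l ⊆ ℂ⁵`, as functions on `l`. -/
def restrictTo (l : Submodule ℂ (Fin 5 → ℂ)) :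
    MvPolynomial (Fin 5) ℂ →ₗ[ℂ] (l → ℂ) :=
  LinearMap.pi fun x => (aeval (x : Fin 5 → ℂ)).toLinearMap

/-- The degree-2 part `J₂ = J ∩ S²` of the Jacobian ideal. -/
def J2 (E : MvPolynomial (Fin 5) ℂ) : Submodule ℂ (MvPolynomial (Fin 5) ℂ) :=
  (jacobianIdeal E).restrictScalars ℂ ⊓ homogeneousSubmodule (Fin 5) ℂ 2

/-- A polynomial over `ℂ` without zeros on an affine line is constant on it. -/
theorem eval_line_eq_of_forall_ne_zero {σ : Type*} (p : MvPolynomial σ ℂ) (u w : σ → ℂ)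
    (h : ∀ t : ℂ, eval (t • u + w) p ≠ 0) (t : ℂ) :
    eval (t • u + w) p = eval w p := by
  let f : Polynomial ℂ :=
    aeval (fun i => Polynomial.C (u i) * Polynomial.X + Polynomial.C (w i)) p
  have hf : ∀ s : ℂ, f.eval s = eval (s • u + w) p := by
    intro s
    have key : ((Polynomial.aeval s).comp
        (aeval fun i => Polynomial.C (u i) * Polynomial.X + Polynomial.C (w i))) =
        aeval (R := ℂ) (s • u + w) := by
      refine MvPolynomial.algHom_ext fun i => ?_
      rw [AlgHom.comp_apply, aeval_X, aeval_X, Polynomial.coe_aeval_eq_eval]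
      rw [Polynomial.eval_add, Polynomial.eval_mul, Polynomial.eval_C, Polynomial.eval_X,
        Polynomial.eval_C, Pi.add_apply, Pi.smul_apply, smul_eq_mul, mul_comm]
    have h := DFunLike.congr_fun key p
    rwa [AlgHom.comp_apply, Polynomial.coe_aeval_eq_eval, MvPolynomial.aeval_eq_eval] at h
  have hdeg : f.degree ≤ 0 := by
    by_contra hd
    obtain ⟨s, hs⟩ := IsAlgClosed.exists_root f fun h0 => hd h0.le
    exact h s (by rw [← hf]; exact hs)
  have h0 := hf 0
  rw [zero_smul, zero_add] at h0
  rw [← hf, ← h0, Polynomial.eq_C_of_degree_le_zero hdeg]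
  simp

/-- A homogeneous polynomial of degree `n` scales with the `n`-th power. -/
theorem eval_smul_of_isHomogeneous_s5 {σ : Type*} {p : MvPolynomial σ ℂ} {n : ℕ}
    (hp : p.IsHomogeneous n) (c : ℂ) (x : σ → ℂ) : eval (c • x) p = c ^ n * eval x p := by
  rw [eval_eq, eval_eq, Finset.mul_sum]
  refine Finset.sum_congr rfl fun d hd => ?_
  have hdeg : ∑ i ∈ d.support, d i = n := (hp.degree_eq_sum_deg_support hd).symm
  simp only [Pi.smul_apply, smul_eq_mul, mul_pow, Finset.prod_mul_distrib]
  rw [Finset.prod_pow_eq_pow_sum, hdeg]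
  ring

/-- A quadratic form over `ℂ` has a nontrivial zero on the span of two independent vectors. -/
theorem exists_ne_zero_eval_eq_zero {σ : Type*} {p : MvPolynomial σ ℂ} (hp : p.IsHomogeneous 2)
    {l : Submodule ℂ (σ → ℂ)} {u w : σ → ℂ} (hu : u ∈ l) (hw : w ∈ l)
    (huw : LinearIndependent ℂ ![u, w]) :
    ∃ x ∈ l, x ≠ 0 ∧ eval x p = 0 := by
  by_contra! H
  rw [LinearIndependent.pair_iff] at huw
  have hf : ∀ t : ℂ, eval (t • u + w) p ≠ 0 := fun t =>
    H _ (l.add_mem (l.smul_mem t hu) hw) fun h0 => by simpa using (huw t 1 (by simpa using h0)).2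
  have hg : ∀ t : ℂ, eval (t • w + u) p ≠ 0 := fun t =>
    H _ (l.add_mem (l.smul_mem t hw) hu) fun h0 => by
      simpa using (huw 1 t (by rw [add_comm]; simpa using h0)).1
  have hfc := eval_line_eq_of_forall_ne_zero p u w hf
  have hgc := eval_line_eq_of_forall_ne_zero p w u hg
  have huw_eq : eval w p = eval u p := by
    rw [← hfc 1, ← hgc 1, one_smul, one_smul, add_comm]
  have hscale : eval ((2 : ℂ) • u + w) p = 4 * eval ((2⁻¹ : ℂ) • w + u) p := by
    have hv : (2 : ℂ) • u + w = (2 : ℂ) • ((2⁻¹ : ℂ) • w + u) := by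
      rw [smul_add, smul_smul, mul_inv_cancel₀ two_ne_zero, one_smul, add_comm]
    rw [hv, eval_smul_of_isHomogeneous_s5 hp]
    norm_num
  rw [hfc, hgc, huw_eq] at hscale
  have h0 := hf 0
  rw [zero_smul, zero_add, huw_eq] at h0
  apply h0
  linear_combination (-1 / 3 : ℂ) * hscale

/-- For every line `l ⊆ ℙ⁴` (2-dimensional linear subspace of `ℂ⁵`), the space `J₂|_l` of
restrictions to `l` of the degree-2 part of the Jacobian ideal of a smooth cubic has
dimension at least 2. -/
theorem statement5 (E : MvPolynomial (Fin 5) ℂ) (hE : IsSmoothCubic E)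
    (l : Submodule ℂ (Fin 5 → ℂ)) (hl : finrank ℂ l = 2) :
    2 ≤ finrank ℂ (Submodule.map (restrictTo l) (J2 E)) := by
  let b : Basis (Fin 2) ℂ l := finBasisOfFinrankEq ℂ l hl
  have huw : LinearIndependent ℂ ![(b 0 : Fin 5 → ℂ), (b 1 : Fin 5 → ℂ)] := by
    have h := b.linearIndependent.map' l.subtype (Submodule.ker_subtype l)
    have hb : l.subtype ∘ b = ![(b 0 : Fin 5 → ℂ), (b 1 : Fin 5 → ℂ)] := by
      funext i
      fin_cases i <;> rfl
    rwa [hb] at h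
  have : FiniteDimensional ℂ (homogeneousSubmodule (Fin 5) ℂ 2) :=
    Module.Finite.iff_fg.mpr (homogeneousSubmodule_fg _ _ 2)
  have : FiniteDimensional ℂ (J2 E) := Submodule.finiteDimensional_of_le inf_le_right
  have hpd : ∀ i, pderiv i E ∈ J2 E := fun i =>
    ⟨Ideal.subset_span ⟨i, rfl⟩, hE.1.pderiv⟩
  by_contra! hlt
  obtain ⟨⟨_, p, hp, rfl⟩, hv⟩ := finrank_le_one_iff.mp (Nat.le_of_lt_succ hlt)
  obtain ⟨x, hxl, hx0, hpx⟩ := exists_ne_zero_eval_eq_zero hp.2 (b 0).2 (b 1).2 huw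
  refine hx0 (hE.2 x fun i => ?_)
  obtain ⟨c, hc⟩ := hv ⟨_, pderiv i E, hpd i, rfl⟩
  have hcx := congrFun (congrArg Subtype.val hc) ⟨x, hxl⟩
  change c * aeval x p = aeval x (pderiv i E) at hcx
  rw [MvPolynomial.aeval_eq_eval, hpx, mul_zero] at hcx
  exact hcx.symm
end
end
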